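/- arXiv:2107.03152 — 3 statements merged into one kernel-verified Lean document; each statement's English description precedes it below -/
import Mathlib

section
/- Let λ,μ,ν ∈ Par_n with c^ν_{λ,μ} > 0, and let k ∈ {1,…,n−1}. Then there exist partitions α and β such that c^{ν_{≤k}}_{λ_{≤k}, α} > 0, c^{ν_{>k}}_{λ_{>k}, β} > 0, and c^μ_{α,β} > 0. -/
/-- `f : ℕ → ℕ` is a partition: weakly decreasing and eventually zero
(the parts are `f 0 ≥ f 1 ≥ …`, 0-indexed). -/
def IsPartition (f : ℕ → ℕ) : Prop :=
  (∀ i j, i ≤ j → f j ≤ f i) ∧ ∃ N, ∀ i, N ≤ i → f i = 0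

/-- The cell in row `i`, column `j` (0-indexed) lies in the skew shape `ν/λ`. -/
def InSkew (lam nu : ℕ → ℕ) (i j : ℕ) : Prop :=
  lam i ≤ j ∧ j < nu i

/-- `p` is read weakly before `q` in the row reading word of a (skew) tableau:
right to left along rows, top to bottom. -/
def ReadBefore (p q : ℕ × ℕ) : Prop :=
  p.1 < q.1 ∨ (p.1 = q.1 ∧ q.2 ≤ p.2)

/-- `T` is a Littlewood–Richardson witness for `c^ν_{λ,μ}`: a semistandard skew
tableau of shape `ν/λ` (entries `≥ 1` on the shape, `0` off the shape) with
content `μ`, whose (reverse) row reading word is ballot.  The conditions that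
`λ, μ, ν` are partitions with `λ ⊆ ν` are built in, so that the associated
count vanishes on non-partitions. -/
def IsLRTableau (lam mu nu : ℕ → ℕ) (T : ℕ → ℕ → ℕ) : Prop :=
  IsPartition lam ∧ IsPartition mu ∧ IsPartition nu ∧
  (∀ i, lam i ≤ nu i) ∧
  (∀ i j, ¬ InSkew lam nu i j → T i j = 0) ∧
  (∀ i j, InSkew lam nu i j → 1 ≤ T i j) ∧
  (∀ i j j', InSkew lam nu i j → InSkew lam nu i j' → j ≤ j' → T i j ≤ T i j') ∧
  (∀ i i' j, InSkew lam nu i j → InSkew lam nu i' j → i < i' → T i j < T i' j) ∧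
  (∀ k, {p : ℕ × ℕ | InSkew lam nu p.1 p.2 ∧ T p.1 p.2 = k + 1}.ncard = mu k) ∧
  (∀ k, ∀ q : ℕ × ℕ, InSkew lam nu q.1 q.2 → T q.1 q.2 = k + 2 →
    {p : ℕ × ℕ | InSkew lam nu p.1 p.2 ∧ T p.1 p.2 = k + 2 ∧ ReadBefore p q}.ncard ≤
      {p : ℕ × ℕ | InSkew lam nu p.1 p.2 ∧ T p.1 p.2 = k + 1 ∧ ReadBefore p q}.ncard)

/-- The Littlewood–Richardson coefficient `c^ν_{λ,μ}` (inner shape `λ`,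
content `μ`, outer shape `ν`). -/
noncomputable def lrCoeff (lam mu nu : ℕ → ℕ) : ℕ :=
  Nat.card {T : ℕ → ℕ → ℕ // IsLRTableau lam mu nu T}

/-- The Newell–Littlewood number `N_{λ,μ,ν} = ∑ c^λ_{α,β} c^μ_{β,γ} c^ν_{γ,α}`. -/
noncomputable def NL (lam mu nu : ℕ → ℕ) : ℕ :=
  ∑ᶠ (a : ℕ → ℕ) (b : ℕ → ℕ) (c : ℕ → ℕ),
    lrCoeff a b lam * lrCoeff b c mu * lrCoeff c a nu

/-- Membership in `Par_n`: a partition with at most `n` parts. -/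
def MemParN (n : ℕ) (f : ℕ → ℕ) : Prop :=
  IsPartition f ∧ ∀ i, n ≤ i → f i = 0

/-- `|λ_A| = ∑_{i ∈ A} λ_i` for `A ⊆ [n] = {1,…,n}` (1-indexed subset,
0-indexed parts). -/
def sumParts (f : ℕ → ℕ) (A : Finset ℕ) : ℕ := ∑ i ∈ A, f (i - 1)

/-- `|λ| = ∑ λ_i`. -/
noncomputable def sizeP (f : ℕ → ℕ) : ℕ := ∑ᶠ i, f i
/-- `λ_{≤k} = (λ_1,…,λ_k)`. -/
def takeP (k : ℕ) (f : ℕ → ℕ) : ℕ → ℕ := fun i => if i < k then f i else 0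

/-- `λ_{>k} = (λ_{k+1},λ_{k+2},…)`. -/
def dropP (k : ℕ) (f : ℕ → ℕ) : ℕ → ℕ := fun i => f (i + k)


namespace LRS
open Finset

def HH (M : ℕ → ℕ → ℤ) (i s : ℕ) : ℤ :=
  ∑ t ∈ range (s+1), M t (i+1) - ∑ t ∈ range s, M t i
def tr (M : ℕ → ℕ → ℤ) : ℕ → ℕ → ℤ := fun a b => M b a
def mv (M : ℕ → ℕ → ℤ) (i s : ℕ) : ℕ → ℕ → ℤ := fun a b =>
  M a b + (if a = s ∧ b = i then 1 else 0) - (if a = s ∧ b = i+1 then 1 else 0)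
def FA (M : ℕ → ℕ → ℤ) (i s : ℕ) : Prop :=
  (∀ t, HH M i t ≤ HH M i s) ∧ (∀ t < s, HH M i t < HH M i s) ∧ 0 < HH M i s
def CS (M M' : ℕ → ℕ → ℤ) : Prop := ∃ i s, FA M i s ∧ M' = mv M i s
def RS (M M' : ℕ → ℕ → ℤ) : Prop := CS (tr M) (tr M')

theorem tr_tr (M : ℕ → ℕ → ℤ) : tr (tr M) = M := rfl

theorem sum_mv (M : ℕ → ℕ → ℤ) (i s a n : ℕ) :
    ∑ b ∈ range n, mv M i s a b = ∑ b ∈ range n, M a b + (if a = s ∧ n = i+1 then 1 else 0) := by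
  induction n with
  | zero => simp
  | succ n ih =>
    rw [sum_range_succ, sum_range_succ, ih]
    simp only [mv]
    split_ifs <;> omega

theorem HH_tr_mv (M : ℕ → ℕ → ℤ) (i s r t : ℕ) :
    HH (tr (mv M i s)) r t = HH (tr M) r t + (if r+1 = s ∧ t = i then 1 else 0)
      - (if r = s ∧ t = i+1 then 1 else 0) := by
  have h1 := sum_mv M i s (r+1) (t+1)
  have h2 := sum_mv M i s r t
  simp only [HH, tr] at *
  rw [h1, h2]
  simp only [Nat.add_right_cancel_iff]
  ring

theorem HH_succ (M : ℕ → ℕ → ℤ) (i r : ℕ) :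
    HH M i (r+1) = HH M i r + M (r+1) (i+1) - M r i := by
  simp only [HH]
  rw [sum_range_succ _ (r+1), sum_range_succ (fun t => M t i) r]
  ring

theorem FA_pos {M : ℕ → ℕ → ℤ} {i s : ℕ} (h0 : ∀ a b, 0 ≤ M a b) (h : FA M i s) :
    1 ≤ M s (i+1) := by
  obtain ⟨h1, h2, h3⟩ := h
  cases s with
  | zero => simp [HH] at h3; omega
  | succ s =>
    have := h2 s (by omega)
    rw [HH_succ] at this
    have := h0 s i
    omega

/-- local comparison -/
theorem FA_cmp {M : ℕ → ℕ → ℤ} {i s : ℕ} (h : FA M i s) (r : ℕ) :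
    (s = r → HH (tr M) r (i+1) ≤ HH (tr M) r i) ∧
    (s = r+1 → HH (tr M) r i + 1 ≤ HH (tr M) r (i+1)) := by
  have e := HH_succ M i r
  have e2 := HH_succ (tr M) r i
  simp only [tr] at e2
  constructor
  · rintro rfl
    have := h.1 (s+1)
    omega
  · rintro rfl
    have := h.2.1 r (by omega)
    omega

theorem bound_iff {M : ℕ → ℕ → ℤ} {i s : ℕ} (h : FA M i s) (r : ℕ) (b : ℤ) :
    (∀ t, HH (tr (mv M i s)) r t ≤ b) ↔ (∀ t, HH (tr M) r t ≤ b) := by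
  obtain ⟨c1, c2⟩ := FA_cmp h r
  constructor
  · intro H t
    have h1 := H t
    have h2 := H i
    have h3 := H (i+1)
    rw [HH_tr_mv] at h1 h2 h3
    by_cases e : r = s ∧ t = i+1
    · have := c1 e.1.symm
      obtain ⟨rfl, rfl⟩ := e
      simp at h2
      omega
    · rw [if_neg e] at h1
      split_ifs at h1 <;> omega
  · intro H t
    rw [HH_tr_mv]
    have h1 := H t
    have h3 := H (i+1)
    by_cases e : r+1 = s ∧ t = i
    · have := c2 e.1.symm
      obtain ⟨rfl, rfl⟩ := e
      simp
      omega
    · rw [if_neg e]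
      split_ifs <;> omega

theorem FA_tr_mv {M : ℕ → ℕ → ℤ} {i s r c x : ℕ} (h : FA M i s) (h' : FA (tr M) r c)
    (hx : (s = r+1 ∧ c = i+1 ∧ M (r+1) (i+1) = M r i + 1) ∧ x = i ∨
      ¬ (s = r+1 ∧ c = i+1 ∧ M (r+1) (i+1) = M r i + 1) ∧ x = c) :
    FA (tr (mv M i s)) r x := by
  obtain ⟨c1, c2⟩ := FA_cmp h r
  have e2 := HH_succ (tr M) r i
  simp only [show tr M (i+1) (r+1) = M (r+1) (i+1) from rfl, show tr M i r = M r i from rfl] at e2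
  obtain ⟨g1, g2, g3⟩ := h'
  have gi := g1 i
  have gi1 := g1 (i+1)
  have gi2 := g2 i
  have hb := (bound_iff h r (HH (tr M) r c)).2 g1
  have key : HH (tr (mv M i s)) r x = HH (tr M) r c := by
    rw [HH_tr_mv]
    rcases hx with ⟨e, rfl⟩ | ⟨e, rfl⟩
    · obtain ⟨rfl, rfl, e⟩ := e
      simp
      omega
    · by_cases q1 : r + 1 = s ∧ x = i
      · exfalso
        obtain ⟨rfl, rfl⟩ := q1
        have := c2 rfl
        omega
      · rw [if_neg q1]
        by_cases q2 : r = s ∧ x = i+1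
        · exfalso
          obtain ⟨rfl, rfl⟩ := q2
          have := c1 rfl
          have := gi2 (by omega)
          omega
        · rw [if_neg q2]; ring
  refine ⟨fun t => by rw [key]; exact hb t, fun t ht => ?_, by rw [key]; exact g3⟩
  rw [key]
  have htc : t < c := by
    rcases hx with ⟨e, rfl⟩ | ⟨e, rfl⟩
    · omega
    · exact ht
  have h1 := g2 t htc
  rw [HH_tr_mv]
  by_cases q1 : r + 1 = s ∧ t = i
  · rw [if_pos q1]
    obtain ⟨rfl, rfl⟩ := q1
    have := c2 rfl
    have e : ¬ (c = t+1 ∧ M (r+1) (t+1) = M r t + 1) := by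
      intro e
      rcases hx with ⟨_, rfl⟩ | ⟨e', rfl⟩
      · omega
      · exact e' ⟨rfl, e⟩
    simp
    by_cases q : c = t+1
    · have q' : ¬ M (r+1) (t+1) = M r t + 1 := fun w => e ⟨q, w⟩
      rw [q] at *
      omega
    · have := g2 (t+1) (by omega)
      omega
  · rw [if_neg q1]
    split_ifs <;> omega

theorem diamond {M A B : ℕ → ℕ → ℤ} (hA : CS M A) (hB : RS M B) :
    ∃ D, RS A D ∧ CS B D := by
  obtain ⟨i, s, h, rfl⟩ := hA
  obtain ⟨r, c, h', hB⟩ := hB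
  have hB' : B = tr (mv (tr M) r c) := by rw [← hB]; rfl
  subst hB'
  by_cases e : s = r+1 ∧ c = i+1 ∧ M (r+1) (i+1) = M r i + 1
  · have k1 := FA_tr_mv h h' (.inl ⟨e, rfl⟩)
    have k2 := FA_tr_mv (M := tr M) h' (by rw [tr_tr]; exact h) (.inl ⟨⟨e.2.1, e.1, e.2.2⟩, rfl⟩)
    refine ⟨_, ⟨r, _, k1, rfl⟩, ⟨i, _, k2, ?_⟩⟩
    funext a b
    obtain ⟨rfl, rfl, e⟩ := e
    simp only [tr, mv, and_comm (a := b = _)]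
    ring
  · have k1 := FA_tr_mv h h' (.inr ⟨e, rfl⟩)
    have k2 := FA_tr_mv (M := tr M) h' (by rw [tr_tr]; exact h)
      (.inr ⟨fun q => e ⟨q.2.1, q.1, q.2.2⟩, rfl⟩)
    refine ⟨_, ⟨r, _, k1, rfl⟩, ⟨i, _, k2, ?_⟩⟩
    funext a b
    simp only [tr, mv]
    ring

open Relation

theorem diamond_star {M A B : ℕ → ℕ → ℤ} (hA : ReflTransGen CS M A) (hB : ReflTransGen RS M B) :
    ∃ D, ReflTransGen RS A D ∧ ReflTransGen CS B D := by
  have strip : ∀ {M A B : ℕ → ℕ → ℤ}, CS M A → ReflTransGen RS M B →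
      ∃ D, ReflTransGen RS A D ∧ CS B D := by
    intro M A B hA hB
    induction hB with
    | refl => exact ⟨A, .refl, hA⟩
    | tail _ h ih =>
      obtain ⟨D, d1, d2⟩ := ih
      obtain ⟨E, e1, e2⟩ := diamond d2 h
      exact ⟨E, d1.tail e1, e2⟩
  induction hA with
  | refl => exact ⟨B, hB, .refl⟩
  | tail _ h ih =>
    obtain ⟨D, d1, d2⟩ := ih
    obtain ⟨E, e1, e2⟩ := strip h d1
    exact ⟨E, e1, d2.tail e2⟩

/-- good matrices -/
def Good (N : ℕ) (M : ℕ → ℕ → ℤ) : Prop :=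
  (∀ a b, 0 ≤ M a b) ∧ (∀ a b, N ≤ a ∨ N ≤ b → M a b = 0)

theorem Good.tr {N : ℕ} {M : ℕ → ℕ → ℤ} (h : Good N M) : Good N (tr M) :=
  ⟨fun a b => h.1 b a, fun a b q => h.2 b a q.symm⟩

theorem Good.mv {N : ℕ} {M : ℕ → ℕ → ℤ} {i s : ℕ} (h : Good N M) (hf : FA M i s) :
    Good N (mv M i s) ∧ s < N ∧ i + 1 < N := by
  have p := FA_pos h.1 hf
  have hs : s < N ∧ i + 1 < N := by
    by_contra q
    have := h.2 s (i+1) (by omega)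
    omega
  refine ⟨⟨fun a b => ?_, fun a b q => ?_⟩, hs⟩
  · have := h.1 a b
    simp only [LRS.mv]
    by_cases e : a = s ∧ b = i+1
    · obtain ⟨rfl, rfl⟩ := e
      simp; omega
    · rw [if_neg e]; split_ifs <;> omega
  · have := h.2 a b q
    simp only [LRS.mv]
    rw [if_neg (by omega), if_neg (by omega), this]; rfl

/-- everything preserved by column steps -/
theorem CS_pres {N : ℕ} {M M' : ℕ → ℕ → ℤ} (h : Good N M) (hs : ReflTransGen CS M M') :
    Good N M' ∧ (∀ r, ∑ b ∈ range N, M' r b = ∑ b ∈ range N, M r b) ∧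
    (∀ r B, (∀ t, HH (tr M') r t ≤ B) ↔ (∀ t, HH (tr M) r t ≤ B)) := by
  induction hs with
  | refl => exact ⟨h, fun _ => rfl, fun _ _ => Iff.rfl⟩
  | tail _ hc ih =>
    obtain ⟨g, q1, q2⟩ := ih
    obtain ⟨i, s, hf, rfl⟩ := hc
    obtain ⟨g', k1, k2⟩ := g.mv hf
    refine ⟨g', fun r => ?_, fun r B => (bound_iff hf r B).trans (q2 r B)⟩
    rw [sum_mv, if_neg (by omega), add_zero, q1]

theorem RS_star {M M' : ℕ → ℕ → ℤ} (hs : ReflTransGen RS M M') : ReflTransGen CS (tr M) (tr M') := by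
  induction hs with
  | refl => exact .refl
  | tail _ h ih => exact ih.tail h

theorem RS_star' {M M' : ℕ → ℕ → ℤ} (hs : ReflTransGen CS M M') : ReflTransGen RS (tr M) (tr M') := by
  induction hs with
  | refl => exact .refl
  | tail _ h ih => exact ih.tail h

theorem HH_stab {N : ℕ} {M : ℕ → ℕ → ℤ} (h : Good N M) (i t : ℕ) (ht : N ≤ t) :
    HH M i t = HH M i N := by
  induction t, ht using Nat.le_induction with
  | base => rfl
  | succ t ht ih => rw [HH_succ, ih, h.2 (t+1) _ (by omega), h.2 t _ (by omega)]; ring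

theorem exists_FA {N : ℕ} {M : ℕ → ℕ → ℤ} (h : Good N M) (i : ℕ) (hp : ∃ t, 0 < HH M i t) :
    ∃ s, FA M i s := by
  obtain ⟨t0, ht0⟩ := hp
  have ex : ∃ s, ∀ t, HH M i t ≤ HH M i s := by
    obtain ⟨s, _, hs⟩ := exists_max_image (range (N+1)) (HH M i) ⟨0, by simp⟩
    refine ⟨s, fun t => ?_⟩
    by_cases q : t ≤ N
    · exact hs t (by simp; omega)
    · rw [HH_stab h i t (by omega)]
      exact hs N (by simp)
  classical
  refine ⟨Nat.find ex, Nat.find_spec ex, fun t ht => ?_, lt_of_lt_of_le ht0 (Nat.find_spec ex t0)⟩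
  have := Nat.find_min ex ht
  push Not at this
  obtain ⟨u, hu⟩ := this
  exact lt_of_lt_of_le hu (Nat.find_spec ex u)

def wt (N : ℕ) (M : ℕ → ℕ → ℤ) : ℤ := ∑ a ∈ range N, ∑ b ∈ range N, (b : ℤ) * M a b

theorem wt_nonneg {N : ℕ} {M : ℕ → ℕ → ℤ} (h : Good N M) : 0 ≤ wt N M :=
  sum_nonneg fun a _ => sum_nonneg fun b _ => mul_nonneg (by positivity) (h.1 a b)

theorem wt_mv (N : ℕ) (M : ℕ → ℕ → ℤ) (i s : ℕ) (hs : s < N) (hi : i + 1 < N) :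
    wt N (mv M i s) = wt N M - 1 := by
  have : ∀ a b : ℕ, (b : ℤ) * mv M i s a b = (b : ℤ) * M a b +
      ((if a = s then (if b = i then (b:ℤ) else 0) else 0)
       - (if a = s then (if b = i+1 then (b:ℤ) else 0) else 0)) := by
    intro a b
    simp only [mv]
    split_ifs <;> first | (exfalso; omega) | ring
  simp only [wt, this, sum_add_distrib, sum_sub_distrib]
  have h1 : ∀ (x : ℕ), x < N → (∑ a ∈ range N, ∑ b ∈ range N, (if a = s then (if b = x then (b:ℤ) else 0) else 0)) = x := by
    intro x hx
    rw [sum_eq_single s]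
    · simp [hx]
    · intro b _ hb; simp [hb]
    · intro q; simp at q; omega
  rw [h1 i (by omega), h1 (i+1) hi]
  push_cast; ring

theorem exists_top {N : ℕ} (n : ℕ) : ∀ {M : ℕ → ℕ → ℤ}, Good N M → wt N M ≤ n →
    ∃ M', ReflTransGen CS M M' ∧ ∀ i t, HH M' i t ≤ 0 := by
  induction n with
  | zero =>
    intro M h hw
    refine ⟨M, .refl, ?_⟩
    by_contra q
    push Not at q
    obtain ⟨i, q⟩ := q
    obtain ⟨s, hf⟩ := exists_FA h i q
    obtain ⟨g, a, b⟩ := h.mv hf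
    have := wt_nonneg g
    rw [wt_mv _ _ _ _ a b] at this
    simp at hw; omega
  | succ n ih =>
    intro M h hw
    by_cases q : ∀ i t, HH M i t ≤ 0
    · exact ⟨M, .refl, q⟩
    push Not at q
    obtain ⟨i, q⟩ := q
    obtain ⟨s, hf⟩ := exists_FA h i q
    obtain ⟨g, a, b⟩ := h.mv hf
    obtain ⟨M', h1, h2⟩ := ih g (by rw [wt_mv _ _ _ _ a b]; push_cast at hw; omega)
    exact ⟨M', .head ⟨i, s, hf, rfl⟩ h1, h2⟩

theorem exists_top' {N : ℕ} {M : ℕ → ℕ → ℤ} (h : Good N M) :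
    ∃ M', ReflTransGen CS M M' ∧ ∀ i t, HH M' i t ≤ 0 :=
  exists_top (wt N M).toNat h (by simp)

theorem upper_zero {M : ℕ → ℕ → ℤ} (h0 : ∀ a b, 0 ≤ M a b) (h : ∀ i t, HH M i t ≤ 0) :
    ∀ j s, s < j → M s j = 0 := by
  have key : ∀ j s, s ≤ j → ∑ t ∈ range s, M t j = 0 := by
    intro j
    induction j with
    | zero => intro s hs; obtain rfl : s = 0 := by omega
              simp
    | succ j ih =>
      intro s hs
      cases s with
      | zero => simp
      | succ s =>
        have h1 := h j s
        have h2 := ih s (by omega)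
        simp only [HH] at h1
        have h3 : 0 ≤ ∑ t ∈ range (s+1), M t (j+1) := sum_nonneg fun a _ => h0 _ _
        omega
  intro j s hs
  have := key j (s+1) hs
  rw [sum_eq_zero_iff_of_nonneg (fun a _ => h0 _ _)] at this
  exact this s (by simp)

theorem core {N : ℕ} {M : ℕ → ℕ → ℤ} (h : Good N M) :
    ∃ A B, Good N A ∧ Good N B ∧
      (∀ i t, HH A i t ≤ 0) ∧ (∀ i t, HH (tr B) i t ≤ 0) ∧
      (∀ r, ∑ b ∈ range N, A r b = ∑ b ∈ range N, M r b) ∧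
      (∀ c, ∑ a ∈ range N, B a c = ∑ a ∈ range N, M a c) ∧
      (∀ r C, (∀ t, HH (tr M) r t ≤ C) → (∀ t, HH (tr A) r t ≤ C)) ∧
      (∀ r C, (∀ t, HH M r t ≤ C) → (∀ t, HH B r t ≤ C)) ∧
      (∀ i, ∑ a ∈ range N, A a i = ∑ b ∈ range N, B i b) := by
  obtain ⟨A, hA, tA⟩ := exists_top' h
  obtain ⟨B', hB', tB⟩ := exists_top' h.tr
  obtain ⟨D, hAD, hBD⟩ := diamond_star hA (RS_star' hB')
  obtain ⟨gA, sA, bA⟩ := CS_pres h hA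
  obtain ⟨gB, sB, bB⟩ := CS_pres h.tr hB'
  obtain ⟨gD, sD, bD⟩ := CS_pres gA.tr (RS_star hAD)
  obtain ⟨gD', sD', bD'⟩ := CS_pres gB.tr hBD
  refine ⟨A, tr B', gA, gB.tr, tA, tB, sA, sB, fun r C => (bA r C).2, fun r C => (bB r C).2, ?_⟩
  intro i
  have u1 := upper_zero gD'.1 (fun i => (bD i 0).2 (tA i))
  have u2 := upper_zero gD.1 (fun i => (bD' i 0).2 (tB i))
  have e1 : ∑ a ∈ range N, A a i = ∑ b ∈ range N, D b i := (sD i).symm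
  rw [e1, ← sD' i]
  refine sum_congr rfl fun b _ => ?_
  rcases lt_trichotomy b i with q | q | q
  · rw [u1 _ _ q]; exact (u2 _ _ q).symm
  · rw [q]
  · rw [u1 _ _ q]; exact u2 _ _ q
end LRS

namespace LRS
open Finset

structure LRMat (N : ℕ) (lam mu nu : ℕ → ℕ) (K : ℕ → ℕ → ℕ) : Prop where
  pl : IsPartition lam
  pm : IsPartition mu
  pn : IsPartition nu
  supp : ∀ a b, N ≤ a ∨ N ≤ b → K a b = 0
  row : ∀ r, lam r + ∑ b ∈ range N, K r b = nu r
  col : ∀ i, ∑ a ∈ range N, K a i = mu i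
  rb : ∀ r j, lam (r+1) + ∑ t ∈ range (j+1), K (r+1) t ≤ lam r + ∑ t ∈ range j, K r t
  cb : ∀ i s, ∑ t ∈ range (s+1), K t (i+1) ≤ ∑ t ∈ range s, K t i

theorem rows_eq (F : ℕ → Finset ℕ) (s : ℕ) :
    {p : ℕ × ℕ | p.1 < s ∧ p.2 ∈ F p.1} =
      (((range s).sigma F).map (Equiv.sigmaEquivProd ℕ ℕ).toEmbedding : Finset (ℕ × ℕ)) := by
  ext ⟨a, b⟩
  simp

theorem rows_fin (F : ℕ → Finset ℕ) (s : ℕ) : {p : ℕ × ℕ | p.1 < s ∧ p.2 ∈ F p.1}.Finite := by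
  rw [rows_eq]; exact Finset.finite_toSet _

theorem ncard_rows (F : ℕ → Finset ℕ) (s : ℕ) :
    {p : ℕ × ℕ | p.1 < s ∧ p.2 ∈ F p.1}.ncard = ∑ t ∈ range s, (F t).card := by
  rw [rows_eq, Set.ncard_coe_finset, card_map, card_sigma]

def FF (lam nu : ℕ → ℕ) (T : ℕ → ℕ → ℕ) (v r : ℕ) : Finset ℕ :=
  (Ico (lam r) (nu r)).filter (fun j => T r j = v + 1)

theorem mem_FF {lam nu : ℕ → ℕ} {T : ℕ → ℕ → ℕ} {v r j : ℕ} :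
    j ∈ FF lam nu T v r ↔ InSkew lam nu r j ∧ T r j = v + 1 := by
  simp [FF, InSkew]

theorem content_eq {lam nu : ℕ → ℕ} {T : ℕ → ℕ → ℕ} {N : ℕ} (hN : ∀ r, N ≤ r → nu r ≤ lam r) (v : ℕ) :
    {p : ℕ × ℕ | InSkew lam nu p.1 p.2 ∧ T p.1 p.2 = v + 1}.ncard =
      ∑ t ∈ range N, (FF lam nu T v t).card := by
  rw [← ncard_rows]
  congr 1
  ext ⟨a, b⟩
  simp only [Set.mem_ofPred_eq, mem_FF]
  constructor
  · intro h
    refine ⟨?_, h⟩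
    by_contra q
    have := hN a (by omega)
    have := h.1
    simp only [InSkew] at this
    omega
  · exact fun h => h.2

theorem card_le {lam nu : ℕ → ℕ} {T : ℕ → ℕ → ℕ} {r : ℕ}
    (hpos : ∀ j, InSkew lam nu r j → 1 ≤ T r j) (i : ℕ) :
    ((Ico (lam r) (nu r)).filter (fun j => T r j ≤ i)).card =
      ∑ t ∈ range i, (FF lam nu T t r).card := by
  induction i with
  | zero =>
    simp only [range_zero, sum_empty, card_eq_zero, filter_eq_empty_iff, mem_Ico]
    intro j hj
    have := hpos j hj
    omega
  | succ i ih =>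
    rw [sum_range_succ, ← ih, ← card_union_of_disjoint]
    · congr 1
      ext j
      simp only [FF, mem_union, mem_filter]
      by_cases hj : j ∈ Ico (lam r) (nu r)
      · simp only [hj, true_and]; omega
      · simp [hj]
    · rw [disjoint_left]
      intro j hj
      simp only [FF, mem_filter] at hj ⊢
      omega

theorem toMat {lam mu nu : ℕ → ℕ} {T : ℕ → ℕ → ℕ} (h : IsLRTableau lam mu nu T) (N : ℕ)
    (hm : ∀ i, N ≤ i → mu i = 0) (hn : ∀ i, N ≤ i → nu i = 0) :
    ∃ K, LRMat N lam mu nu K := by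
  obtain ⟨pl, pm, pn, hsub, hout, hpos, hrow, hcol, hcont, hbal⟩ := h
  have hN : ∀ r, N ≤ r → nu r ≤ lam r := fun r hr => by rw [hn r hr]; omega
  have col : ∀ i, ∑ a ∈ range N, (FF lam nu T i a).card = mu i := fun i => by
    rw [← hcont i, content_eq hN]
  have supp : ∀ a b, N ≤ a ∨ N ≤ b → (FF lam nu T b a).card = 0 := by
    intro a b q
    by_cases ha : N ≤ a
    · rw [card_eq_zero]
      ext j
      simp only [mem_FF, InSkew]
      have := hN a ha
      simp
      omega
    · have h1 := col b
      rw [hm b (by omega), sum_eq_zero_iff] at h1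
      exact h1 a (by simp; omega)
  have le_iff : ∀ r x i, InSkew lam nu r x →
      (T r x ≤ i ↔ x < lam r + ∑ t ∈ range i, (FF lam nu T t r).card) := by
    intro r x i hx
    rw [← card_le (hpos r)]
    constructor
    · intro hT
      have : Ico (lam r) (x+1) ⊆ (Ico (lam r) (nu r)).filter (fun j => T r j ≤ i) := by
        intro y hy
        simp only [mem_Ico, mem_filter] at hy ⊢
        have hy' : InSkew lam nu r y := ⟨hy.1, by have := hx.2; omega⟩
        exact ⟨hy', (hrow r y x hy' hx (by omega)).trans hT⟩
      have := card_le_card this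
      rw [Nat.card_Ico] at this
      have := hx.1
      omega
    · intro hT
      by_contra q
      have : (Ico (lam r) (nu r)).filter (fun j => T r j ≤ i) ⊆ Ico (lam r) x := by
        intro y hy
        simp only [mem_Ico, mem_filter] at hy ⊢
        refine ⟨hy.1.1, ?_⟩
        by_contra w
        have := hrow r x y hx hy.1 (by omega)
        omega
      have := card_le_card this
      rw [Nat.card_Ico] at this
      have := hx.1
      omega
  have tot : ∀ r i, ∑ t ∈ range i, (FF lam nu T t r).card ≤ nu r - lam r := by
    intro r i
    rw [← card_le (hpos r), ← Nat.card_Ico]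
    exact card_filter_le _ _
  refine ⟨fun r i => (FF lam nu T i r).card, pl, pm, pn, supp, ?_, col, ?_, ?_⟩
  · intro r
    rw [← card_le (hpos r), filter_true_of_mem, Nat.card_Ico]
    · have := hsub r; omega
    · intro j hj
      rw [mem_Ico] at hj
      have h1 := hpos r j hj
      by_contra q
      have h2 := supp r (T r j - 1) (by omega)
      rw [card_eq_zero] at h2
      have h3 : j ∈ FF lam nu T (T r j - 1) r := mem_FF.2 ⟨hj, by omega⟩
      rw [h2] at h3
      simp at h3
  · intro r j
    by_contra q
    push Not at q
    set x := lam r + ∑ t ∈ range j, (FF lam nu T t r).card with hx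
    have h1 := tot (r+1) (j+1)
    have h2 := hsub (r+1)
    have h3 := pn.1 r (r+1) (by omega)
    have h4 := pl.1 r (r+1) (by omega)
    have s1 : InSkew lam nu (r+1) x := ⟨by omega, by omega⟩
    have s0 : InSkew lam nu r x := ⟨by omega, by have := s1.2; omega⟩
    have a1 := (le_iff _ _ _ s1).2 q
    have a0 := mt (le_iff r x j s0).1 (by omega)
    have := hcol r (r+1) x s0 s1 (by omega)
    omega
  · intro i s
    induction s with
    | zero =>
      simp only [zero_add, range_one, sum_singleton, range_zero, sum_empty, nonpos_iff_eq_zero]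
      by_contra q
      obtain ⟨x, hx⟩ := card_pos.1 (Nat.pos_of_ne_zero q)
      rw [mem_FF] at hx
      have hb := hbal i (0, x) hx.1 hx.2
      have e : {p : ℕ × ℕ | InSkew lam nu p.1 p.2 ∧ T p.1 p.2 = i + 1 ∧ ReadBefore p (0, x)} = ∅ := by
        ext ⟨a, b⟩
        simp only [Set.mem_ofPred_eq, ReadBefore, Set.mem_empty_iff_false, iff_false]
        rintro ⟨h1, h2, h3⟩
        have h4 : a = 0 ∧ x ≤ b := by omega
        obtain ⟨rfl, h4⟩ := h4
        have := hrow 0 x b hx.1 h1 h4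
        omega
      have hf : {p : ℕ × ℕ | InSkew lam nu p.1 p.2 ∧ T p.1 p.2 = i + 2 ∧ ReadBefore p (0, x)}.Finite := by
        refine (rows_fin (FF lam nu T (i+1)) 1).subset ?_
        rintro ⟨a, b⟩ ⟨h1, h2, h3⟩
        simp only [ReadBefore] at h3
        exact ⟨by simp; omega, mem_FF.2 ⟨h1, h2⟩⟩
      rw [e, Set.ncard_empty, Nat.le_zero, Set.ncard_eq_zero hf] at hb
      have : (0, x) ∈ (∅ : Set (ℕ × ℕ)) := by
        rw [← hb]
        exact ⟨hx.1, hx.2, Or.inr ⟨rfl, le_rfl⟩⟩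
      simp at this
    | succ s ih =>
      by_cases q : (FF lam nu T (i+1) (s+1)).card = 0
      · rw [sum_range_succ, q]
        refine le_trans ?_ (sum_le_sum_of_subset (range_mono (Nat.le_succ s)))
        simpa using ih
      · have hne := card_pos.1 (Nat.pos_of_ne_zero q)
        set x := (FF lam nu T (i+1) (s+1)).min' hne with hxd
        have hx := min'_mem _ hne
        rw [← hxd] at hx
        have hmin : ∀ y ∈ FF lam nu T (i+1) (s+1), x ≤ y := fun y hy => min'_le _ _ hy
        rw [mem_FF] at hx
        have hb := hbal i (s+1, x) hx.1 hx.2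
        rw [← ncard_rows, ← ncard_rows]
        convert hb using 2
        · ext ⟨a, b⟩
          simp only [Set.mem_ofPred_eq, mem_FF, ReadBefore]
          constructor
          · rintro ⟨h1, h2, h3⟩
            refine ⟨h2, h3, ?_⟩
            by_cases ha : a = s+1
            · subst ha
              exact Or.inr ⟨rfl, hmin b (mem_FF.2 ⟨h2, h3⟩)⟩
            · left; omega
          · rintro ⟨h1, h2, h3⟩
            exact ⟨by omega, h1, h2⟩
        · ext ⟨a, b⟩
          simp only [Set.mem_ofPred_eq, mem_FF, ReadBefore]
          constructor
          · rintro ⟨h1, h2, h3⟩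
            exact ⟨h2, h3, Or.inl h1⟩
          · rintro ⟨h1, h2, h3⟩
            refine ⟨?_, h1, h2⟩
            rcases h3 with h3 | ⟨rfl, h3⟩
            · exact h3
            · have := hrow _ x b hx.1 h1 h3
              omega

theorem ofMat {N : ℕ} {lam mu nu : ℕ → ℕ} {K : ℕ → ℕ → ℕ} (h : LRMat N lam mu nu K) :
    ∃ T, IsLRTableau lam mu nu T := by
  classical
  obtain ⟨pl, pm, pn, supp, row, col, rb, cb⟩ := h
  let P : ℕ → ℕ → ℕ := fun r i => lam r + ∑ t ∈ range i, K r t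
  have Pmono : ∀ r i j, i ≤ j → P r i ≤ P r j := fun r i j hij =>
    Nat.add_le_add_left (sum_le_sum_of_subset (range_mono hij)) _
  have PN : ∀ r, P r N = nu r := row
  have P0 : ∀ r, P r 0 = lam r := fun r => by simp [P]
  have Ple : ∀ r i, P r i ≤ nu r := by
    intro r i
    by_cases q : i ≤ N
    · rw [← PN]; exact Pmono _ _ _ q
    · rw [← PN]
      apply le_of_eq
      have : ∑ t ∈ range N, K r t = ∑ t ∈ range i, K r t :=
        sum_subset (range_mono (by omega)) (fun x _ hx => supp _ _ (by simp at hx; omega))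
      simp only [P, this]
  have hsub : ∀ r, lam r ≤ nu r := fun r => by rw [← row r]; omega
  let T : ℕ → ℕ → ℕ := fun r x => if InSkew lam nu r x then sInf {i | x < P r i} else 0
  have Tle : ∀ r x i, InSkew lam nu r x → (T r x ≤ i ↔ x < P r i) := by
    intro r x i hx
    simp only [T, if_pos hx]
    have hne : {i | x < P r i}.Nonempty := ⟨N, by simp only [Set.mem_ofPred_eq, PN]; exact hx.2⟩
    constructor
    · intro q
      have h1 : x < P r (sInf {i | x < P r i}) := Nat.sInf_mem hne
      exact lt_of_lt_of_le h1 (Pmono _ _ _ q)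
    · intro q
      exact Nat.sInf_le q
  have hpos : ∀ r x, InSkew lam nu r x → 1 ≤ T r x := by
    intro r x hx
    by_contra q
    have := (Tle r x 0 hx).1 (by omega)
    rw [P0] at this
    have := hx.1
    omega
  have cardK : ∀ v r, (FF lam nu T v r).card = K r v := by
    intro v r
    have : FF lam nu T v r = Ico (P r v) (P r (v+1)) := by
      ext x
      rw [mem_FF, mem_Ico]
      constructor
      · rintro ⟨h1, h2⟩
        have a := Tle r x v h1
        have b := Tle r x (v+1) h1
        omega
      · rintro ⟨h1, h2⟩
        have h3 : InSkew lam nu r x := ⟨by have := Pmono r 0 v (by omega); rw [P0] at this; omega,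
          by have := Ple r (v+1); omega⟩
        have a := Tle r x v h3
        have b := Tle r x (v+1) h3
        exact ⟨h3, by omega⟩
    rw [this, Nat.card_Ico]
    simp only [P, sum_range_succ]
    omega
  have hrow : ∀ i j j', InSkew lam nu i j → InSkew lam nu i j' → j ≤ j' → T i j ≤ T i j' := by
    intro r x y hx hy hxy
    rw [Tle r x _ hx]
    have := (Tle r y _ hy).1 le_rfl
    omega
  have hadj : ∀ r x, InSkew lam nu r x → InSkew lam nu (r+1) x → T r x < T (r+1) x := by
    intro r x h0 h1
    have p := hpos _ _ h1
    obtain ⟨j, hj⟩ : ∃ j, T (r+1) x = j + 1 := ⟨T (r+1) x - 1, by omega⟩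
    have a := (Tle _ _ _ h1).1 hj.le
    have b := rb r j
    have c := (Tle r x j h0).2 (lt_of_lt_of_le a b)
    omega
  refine ⟨T, pl, pm, pn, hsub, fun i j q => if_neg q, hpos, hrow, ?_, ?_, ?_⟩
  · intro r r' x h0 h1 hr
    induction r', hr using Nat.le_induction with
    | base => exact hadj r x h0 h1
    | succ r' hr ih =>
      have h2 : InSkew lam nu r' x :=
        ⟨(pl.1 r r' (by omega)).trans h0.1, lt_of_lt_of_le h1.2 (pn.1 r' (r'+1) (by omega))⟩
      exact (ih h2).trans (hadj r' x h2 h1)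
  · intro v
    rw [content_eq (N := N)]
    · simp only [cardK, col]
    · intro r hr
      rw [← row r, sum_eq_zero (fun b _ => supp r b (Or.inl hr))]
      omega
  · rintro i ⟨s, x⟩ hq hT
    have h1 := cb i s
    simp only [← cardK, ← ncard_rows] at h1
    refine le_trans (Set.ncard_le_ncard ?_ (rows_fin _ _)) (h1.trans (Set.ncard_le_ncard ?_ ?_))
    · rintro ⟨a, b⟩ ⟨h1, h2, h3⟩
      simp only [ReadBefore] at h3
      exact ⟨by simp; omega, mem_FF.2 ⟨h1, h2⟩⟩
    · rintro ⟨a, b⟩ ⟨h1, h2⟩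
      have := mem_FF.1 h2
      exact ⟨this.1, this.2, Or.inl h1⟩
    · refine (rows_fin (FF lam nu T i) (s+1)).subset ?_
      rintro ⟨a, b⟩ ⟨h1, h2, h3⟩
      simp only [ReadBefore] at h3
      exact ⟨by simp; omega, mem_FF.2 ⟨h1, h2⟩⟩

theorem finT (lam mu nu : ℕ → ℕ) : Finite {T : ℕ → ℕ → ℕ // IsLRTableau lam mu nu T} := by
  classical
  by_cases hp : IsPartition mu ∧ IsPartition nu
  swap
  · have : IsEmpty {T : ℕ → ℕ → ℕ // IsLRTableau lam mu nu T} :=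
      ⟨fun T => hp ⟨T.2.2.1, T.2.2.2.1⟩⟩
    infer_instance
  obtain ⟨⟨m1, N1, m2⟩, ⟨n1, N2, n2⟩⟩ := hp
  set N := max N1 N2
  have hbd : ∀ T, IsLRTableau lam mu nu T → ∀ i j, T i j < N + 1 := by
    intro T h i j
    obtain ⟨pl, pm, pn, hsub, hout, hpos, hrow, hcol, hcont, hbal⟩ := h
    by_cases hs : InSkew lam nu i j
    · by_contra q
      have h1 := hcont (T i j - 1)
      rw [m2 _ (by omega), content_eq (N := N) (fun r hr => by rw [n2 r (by omega)]; omega),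
        sum_eq_zero_iff] at h1
      have hi : i < N := by
        by_contra w
        have := n2 i (by omega)
        have := hs.2
        omega
      have h2 := h1 i (by simpa using hi)
      rw [card_eq_zero] at h2
      have h3 : j ∈ FF lam nu T (T i j - 1) i := mem_FF.2 ⟨hs, by omega⟩
      rw [h2] at h3
      simp at h3
    · rw [hout i j hs]; omega
  have hbox : ∀ T, IsLRTableau lam mu nu T → ∀ i j, ¬ (i < N ∧ j < nu 0) → T i j = 0 := by
    intro T h i j q
    apply h.2.2.2.2.1
    rintro ⟨h1, h2⟩
    have := n1 0 i (by omega)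
    have : N ≤ i → nu i = 0 := fun w => n2 i (by omega)
    omega
  let f : {T : ℕ → ℕ → ℕ // IsLRTableau lam mu nu T} → (Fin N → Fin (nu 0) → Fin (N+1)) :=
    fun T i j => ⟨T.1 i j, hbd T.1 T.2 i j⟩
  refine Finite.of_injective f ?_
  intro T T' h
  apply Subtype.ext
  funext i j
  by_cases q : i < N ∧ j < nu 0
  · have := congrFun (congrFun h ⟨i, q.1⟩) ⟨j, q.2⟩
    simpa [f] using this
  · rw [hbox T.1 T.2 i j q, hbox T'.1 T'.2 i j q]

theorem pos_of_mat {N : ℕ} {lam mu nu : ℕ → ℕ} {K : ℕ → ℕ → ℕ} (h : LRMat N lam mu nu K) :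
    0 < lrCoeff lam mu nu := by
  obtain ⟨T, hT⟩ := ofMat h
  have := finT lam mu nu
  have : Nonempty {T : ℕ → ℕ → ℕ // IsLRTableau lam mu nu T} := ⟨⟨T, hT⟩⟩
  exact Nat.card_pos

end LRS

namespace LRS
open Finset

theorem lift_mat {N : ℕ} {M : ℕ → ℕ → ℤ} (h : Good N M) :
    ∃ K : ℕ → ℕ → ℕ, M = fun a b => (K a b : ℤ) :=
  ⟨fun a b => (M a b).toNat, by
    funext a b
    exact (Int.toNat_of_nonneg (h.1 a b)).symm⟩

theorem part_of_succ {f : ℕ → ℕ} {N : ℕ} (h : ∀ i, f (i+1) ≤ f i) (h0 : ∀ i, N ≤ i → f i = 0) :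
    IsPartition f :=
  ⟨fun _ _ hij => antitone_nat_of_succ_le h hij, N, h0⟩

theorem main (n : ℕ) (lam mu nu : ℕ → ℕ)
    (hl : MemParN n lam) (hm : MemParN n mu) (hv : MemParN n nu)
    (k : ℕ) (hk2 : k < n)
    (hc : 0 < lrCoeff lam mu nu) :
    ∃ alpha beta : ℕ → ℕ, IsPartition alpha ∧ IsPartition beta ∧
      0 < lrCoeff (takeP k lam) alpha (takeP k nu) ∧
      0 < lrCoeff (dropP k lam) beta (dropP k nu) ∧
      0 < lrCoeff alpha beta mu := by
  obtain ⟨⟨T, hT⟩⟩ := (Nat.card_pos_iff.1 hc).1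
  obtain ⟨K, pl, pm, pn, supp, row, col, rb, cb⟩ := toMat hT n hm.2 hv.2
  set al : ℕ → ℕ := fun i => ∑ r ∈ range k, K r i with hal
  have cb' : ∀ i s, ∑ t ∈ range s, K t (i+1) ≤ ∑ t ∈ range s, K t i := fun i s =>
    le_trans (sum_le_sum_of_subset (range_mono (Nat.le_succ s))) (cb i s)
  have pa : IsPartition al := part_of_succ (N := n) (fun i => cb' i k)
    (fun i hi => sum_eq_zero fun r _ => supp r i (Or.inr hi))
  have ptake : ∀ f, IsPartition f → IsPartition (takeP k f) := by
    intro f hf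
    refine part_of_succ (N := k) (fun i => ?_) (fun i hi => if_neg (by omega))
    have := hf.1 i (i+1) (by omega)
    simp only [takeP]
    split_ifs <;> omega
  have pdrop : ∀ f, IsPartition f → IsPartition (dropP k f) := by
    rintro f ⟨hf, N, hN⟩
    exact ⟨fun i j hij => hf _ _ (by omega), N, fun i hi => hN _ (by omega)⟩
  -- top part
  have top : LRMat n (takeP k lam) al (takeP k nu) (fun r i => if r < k then K r i else 0) := by
    have hs : ∀ i m, ∑ r ∈ range m, (if r < k then K r i else 0) = ∑ r ∈ range (min m k), K r i := by
      intro i m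
      induction m with
      | zero => simp
      | succ m ih =>
        rw [sum_range_succ, ih]
        by_cases q : m < k
        · rw [if_pos q, min_eq_left q.le, min_eq_left (by omega), sum_range_succ]
        · rw [if_neg q, min_eq_right (by omega), min_eq_right (by omega), add_zero]
    refine ⟨ptake _ pl, pa, ptake _ pn, ?_, ?_, ?_, ?_, ?_⟩
    · intro a b q
      simp only [supp a b q, ite_self]
    · intro r
      simp only [takeP]
      by_cases q : r < k
      · simp only [if_pos q, row]
      · simp [if_neg q]
    · intro i
      rw [hs, min_eq_right hk2.le]
    · intro r j
      simp only [takeP]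
      by_cases q : r + 1 < k
      · have q' : r < k := by omega
        simp only [if_pos q, if_pos q']
        exact rb r j
      · simp [if_neg q]
    · intro i s
      rw [hs, hs]
      by_cases q : s < k
      · rw [min_eq_left q.le, min_eq_left (by omega)]
        exact cb i s
      · rw [min_eq_right (by omega), min_eq_right (by omega)]
        exact cb' i k
  -- bottom part
  set M : ℕ → ℕ → ℤ := fun r i => (K (k + r) i : ℤ) with hM
  have gM : Good n M := by
    refine ⟨fun a b => by simp [hM], fun a b q => ?_⟩
    simp only [hM]
    exact_mod_cast supp (k + a) b (by omega)
  have split : ∀ i m, ∑ r ∈ range m, M r i =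
      ((∑ r ∈ range (k + m), K r i : ℕ) : ℤ) - (al i : ℤ) := by
    intro i m
    rw [sum_range_add]
    simp only [hM, hal]
    push_cast
    ring
  have colM : ∀ i, ∑ r ∈ range n, M r i = (mu i : ℤ) - al i := by
    intro i
    rw [split, ← col i]
    have : ∑ r ∈ range n, K r i = ∑ r ∈ range (k + n), K r i :=
      sum_subset (range_mono (by omega)) (fun x _ hx => supp _ _ (by simp at hx; omega))
    rw [this]
  have cM : ∀ i t, HH M i t ≤ (al i : ℤ) - al (i+1) := by
    intro i t
    simp only [HH]
    rw [split, split]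
    have : ∑ r ∈ range (k + t + 1), K r (i+1) ≤ ∑ r ∈ range (k + t), K r i := cb i (k+t)
    rw [← add_assoc]
    zify at this ⊢
    linarith
  have rM : ∀ r t, HH (tr M) r t ≤ (dropP k lam r : ℤ) - dropP k lam (r+1) := by
    intro r t
    have := rb (k + r) t
    simp only [HH, tr, hM, dropP]
    rw [show r + k = k + r by omega, show r + 1 + k = k + r + 1 by omega, ← add_assoc]
    zify at this
    linarith
  obtain ⟨A, B, gA, gB, cA, rB, rowA, colB, rA, cB, hAB⟩ := core gM
  have rA' := fun r => rA r _ (rM r)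
  have cB' := fun i => cB i _ (cM i)
  obtain ⟨A, rfl⟩ := lift_mat gA
  obtain ⟨B, rfl⟩ := lift_mat gB
  simp only [HH, tr] at cA rB rA' cB'
  set be : ℕ → ℕ := fun i => ∑ a ∈ range n, A a i with hbe
  have suppA : ∀ a b, n ≤ a ∨ n ≤ b → A a b = 0 := fun a b q => by
    have h := gA.2 a b q
    beta_reduce at h
    exact_mod_cast h
  have suppB : ∀ a b, n ≤ a ∨ n ≤ b → B a b = 0 := fun a b q => by
    have h := gB.2 a b q
    beta_reduce at h
    exact_mod_cast h
  have cbA : ∀ i s, ∑ t ∈ range (s+1), A t (i+1) ≤ ∑ t ∈ range s, A t i := by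
    intro i s
    have := cA i s
    zify
    linarith
  have pb : IsPartition be := part_of_succ (N := n)
    (fun i => le_trans (sum_le_sum_of_subset (range_mono (Nat.le_succ n))) (cbA i n))
    (fun i hi => sum_eq_zero fun r _ => suppA r i (Or.inr hi))
  have bot : LRMat n (dropP k lam) be (dropP k nu) A := by
    refine ⟨pdrop _ pl, pb, pdrop _ pn, suppA, ?_, fun _ => rfl, ?_, cbA⟩
    · intro r
      have h1 := rowA r
      have h2 := row (k + r)
      simp only [hM] at h1
      have h3 : ∑ b ∈ range n, A r b = ∑ b ∈ range n, K (k+r) b := by exact_mod_cast h1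
      simp only [dropP]
      rw [h3, show r + k = k + r by omega, h2]
    · intro r j
      have := rA' r j
      zify
      linarith
  have last : LRMat n al be mu (fun a b => B b a) := by
    refine ⟨pa, pb, pm, fun a b q => suppB b a q.symm, ?_, ?_, ?_, ?_⟩
    · intro r
      have h1 := colB r
      rw [colM] at h1
      zify
      linarith
    · intro i
      have h1 := hAB i
      beta_reduce at h1
      simp only [hbe]
      exact_mod_cast h1.symm
    · intro r j
      have := cB' r j
      zify
      linarith
    · intro i s
      have := rB i s
      zify
      linarith
  exact ⟨al, be, pa, pb, pos_of_mat top, pos_of_mat bot, pos_of_mat last⟩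

end LRS

/-- **Proposition (splitting of a positive LR coefficient).**
If `λ,μ,ν ∈ Par_n` with `c^ν_{λ,μ} > 0` and `k ∈ {1,…,n−1}`, then there are
partitions `α, β` with `c^{ν_{≤k}}_{λ_{≤k},α} > 0`, `c^{ν_{>k}}_{λ_{>k},β} > 0`
and `c^μ_{α,β} > 0`. -/
theorem stmt10 (n : ℕ) (lam mu nu : ℕ → ℕ)
    (hl : MemParN n lam) (hm : MemParN n mu) (hv : MemParN n nu)
    (k : ℕ) (hk1 : 1 ≤ k) (hk2 : k < n)
    (hc : 0 < lrCoeff lam mu nu) :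
    ∃ alpha beta : ℕ → ℕ, IsPartition alpha ∧ IsPartition beta ∧
      0 < lrCoeff (takeP k lam) alpha (takeP k nu) ∧
      0 < lrCoeff (dropP k lam) beta (dropP k nu) ∧
      0 < lrCoeff alpha beta mu := by
  exact LRS.main n lam mu nu hl hm hv k hk2 hc
end

section
/- Let 1 ≤ r < n and let λ,μ,ν ⊆ ((n−r)^r) be partitions such that c^{ν^{∨[(n−r)^r]}}_{λ,μ} > 0. Let a',b',c' be nonnegative integers with a' + b' + c' = r, and set λ⁻ = (λ_{≤a'})^{∨[(n−r)^{a'}]}, λ⁺ = λ_{>a'}, μ⁻ = (μ_{≤b'})^{∨[(n−r)^{b'}]}, μ⁺ = μ_{>b'}, ν⁻ = (ν_{≤c'})^{∨[(n−r)^{c'}]}, ν⁺ = ν_{>c'}. Then the multiple Newell–Littlewood number N_{λ⁻, μ⁺, ν⁻, λ⁺, μ⁻, ν⁺} is positive. -/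
/-- The multiple Newell–Littlewood number
`N_{λ₁,…,λ₆} = ∑ ∏_{i ∈ ℤ/6ℤ} c^{λ_i}_{α_i,α_{i+1}}`. -/
noncomputable def NL6 (l1 l2 l3 l4 l5 l6 : ℕ → ℕ) : ℕ :=
  ∑ᶠ (a1 : ℕ → ℕ) (a2 : ℕ → ℕ) (a3 : ℕ → ℕ) (a4 : ℕ → ℕ) (a5 : ℕ → ℕ) (a6 : ℕ → ℕ),
    lrCoeff a1 a2 l1 * lrCoeff a2 a3 l2 * lrCoeff a3 a4 l3 *
      lrCoeff a4 a5 l4 * lrCoeff a5 a6 l5 * lrCoeff a6 a1 l6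
/-- The complement `λ^{∨[c^ℓ]}` of a partition `λ ⊆ (c^ℓ)`. -/
def compP (c l : ℕ) (f : ℕ → ℕ) : ℕ → ℕ := fun k =>
  if k < l then c - f (l - 1 - k) else 0

/-- Partial sums. -/
def ps (f : ℕ → ℕ) (p : ℕ) : ℕ := ∑ q ∈ Finset.range p, f q

lemma ps_zero (f : ℕ → ℕ) : ps f 0 = 0 := by simp [ps]

lemma ps_succ (f : ℕ → ℕ) (p : ℕ) : ps f (p + 1) = ps f p + f p := by
  simp [ps, Finset.sum_range_succ]

lemma ps_mono {f g : ℕ → ℕ} (h : ∀ p, f p ≤ g p) (p : ℕ) : ps f p ≤ ps g p :=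
  Finset.sum_le_sum fun _ _ => h _

lemma ps_stab {f : ℕ → ℕ} {N : ℕ} (h : ∀ p, N ≤ p → f p = 0) :
    ∀ p, N ≤ p → ps f p = ps f N := by
  intro p hp
  induction p, hp using Nat.le_induction with
  | base => rfl
  | succ p hp ih => rw [ps_succ, ih, h p hp]; rfl

/-- Horizontal strip. -/
def Strip (f g : ℕ → ℕ) : Prop := (∀ p, f p ≤ g p) ∧ ∀ p, g (p + 1) ≤ f p

/-- Ballot condition for two consecutive strips. -/
def Bal (f g h : ℕ → ℕ) : Prop :=
  ∀ p, ps h (p + 1) + ps f p ≤ ps g (p + 1) + ps g p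

/-- Chain form of a Littlewood-Richardson tableau. -/
def LRChain (lam mu nu : ℕ → ℕ) : Prop :=
  ∃ (S : ℕ → ℕ → ℕ) (N : ℕ), S 0 = lam ∧ (∀ e, N ≤ e → S e = nu) ∧
    (∀ e p, N ≤ p → S e p = 0) ∧ (∀ e, Strip (S e) (S (e + 1))) ∧
    (∀ e, Bal (S e) (S (e + 1)) (S (e + 2))) ∧
    ∀ e, ps (S (e + 1)) N = ps (S e) N + mu e

/-- Local switching rule. -/
def op (K L M : ℕ → ℕ) : ℕ → ℕ
  | 0 => M 0 + max (K 0) (M (0 + 1)) - L 0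
  | p + 1 => min (K p) (M (p + 1)) + max (K (p + 1)) (M (p + 1 + 1)) - L (p + 1)

lemma op_strip {K L M : ℕ → ℕ} (h1 : Strip K L) (h2 : Strip L M) :
    Strip K (op K L M) ∧ Strip (op K L M) M := by
  obtain ⟨a1, a2⟩ := h1
  obtain ⟨b1, b2⟩ := h2
  refine ⟨⟨?_, ?_⟩, ⟨?_, ?_⟩⟩
  · intro p
    cases p with
    | zero => have := b1 0; have := a1 0; have := b2 0; simp only [op]; omega
    | succ p =>
      have := b1 (p+1); have := a1 (p+1); have := b2 (p+1); have := a2 p; simp only [op]; omega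
  · intro p
    have := b1 (p+1); have := a1 (p+1); have := b2 (p+1); have := a2 p; simp only [op]; omega
  · intro p
    cases p with
    | zero => have := b1 0; have := a1 0; have := b2 0; simp only [op]; omega
    | succ p =>
      have := b1 (p+1); have := a1 (p+1); have := b2 (p+1); have := a2 p; simp only [op]; omega
  · intro p
    cases p with
    | zero => have := b1 0; have := a1 0; have := b2 0; simp only [op]; omega
    | succ p =>
      have := b1 (p+1); have := a1 (p+1); have := b2 (p+1); have := a2 p; simp only [op]; omega

lemma op_same {K L : ℕ → ℕ} (h1 : Strip K L) : op K L L = K := by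
  obtain ⟨a1, a2⟩ := h1
  funext p
  cases p with
  | zero => have := a1 0; have := a2 0; simp only [op]; omega
  | succ p => have := a1 (p+1); have := a2 (p+1); have := a2 p; simp only [op]; omega

lemma op_oct {K L M : ℕ → ℕ} (h1 : Strip K L) (h2 : Strip L M) (p : ℕ) :
    ps (op K L M) (p + 1) + ps L (p + 1) =
      max (ps K (p + 1) + ps M (p + 1)) (ps K p + ps M (p + 2)) := by
  obtain ⟨a1, a2⟩ := h1
  obtain ⟨b1, b2⟩ := h2
  induction p with
  | zero =>
    have := b1 0; have := a1 0; have := b2 0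
    simp only [ps_succ, ps_zero, op, zero_add] at *; omega
  | succ p ih =>
    rw [ps_succ (op K L M), ps_succ L]
    have := b1 (p+1); have := a1 (p+1); have := b2 (p+1); have := a2 p
    have e1 := ps_succ K (p+1)
    have e2 := ps_succ M (p+1)
    have e3 := ps_succ M (p+2)
    have e4 := ps_succ K p
    have e5 : op K L M (p+1) = min (K p) (M (p + 1)) + max (K (p + 1)) (M (p + 2)) - L (p + 1) := rfl
    simp only [add_assoc] at *
    norm_num at *
    omega

lemma op_ge {K L M : ℕ → ℕ} (h1 : Strip K L) (h2 : Strip L M) (p : ℕ) :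
    ps K p + ps M p ≤ ps (op K L M) p + ps L p := by
  cases p with
  | zero => simp [ps_zero]
  | succ p => rw [op_oct h1 h2]; exact le_max_left _ _

lemma op_ge2 {K L M : ℕ → ℕ} (h1 : Strip K L) (h2 : Strip L M) (p : ℕ) :
    ps K p + ps M (p + 2) ≤ ps (op K L M) (p + 1) + ps L (p + 1) := by
  rw [op_oct h1 h2]; exact le_max_right _ _

lemma op_bal {x0 x1 x2 y2 : ℕ → ℕ} (s0 : Strip x0 x1) (s1 : Strip x1 x2) (t2 : Strip x2 y2)
    (hb : Bal x0 x1 x2) :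
    Bal (op x0 x1 (op x1 x2 y2)) (op x1 x2 y2) y2 := by
  have t1 := op_strip s1 t2
  intro p
  cases p with
  | zero =>
    have h1 := op_ge s1 t2 1
    have h2 := hb 0
    simp only [zero_add, ps_zero, add_zero] at *
    omega
  | succ p =>
    have h1 := op_oct s0 t1.1 p
    have h2 := op_ge s1 t2 (p+2)
    have h3 := op_ge2 s1 t2 p
    have h4 := hb (p+1)
    have h5 := hb p
    have e : p + 1 + 1 = p + 2 := rfl
    simp only [e] at *
    omega

lemma op_dom {x0 x1 x2 y0 : ℕ → ℕ} {k0 k1 : ℕ} (t0 : Strip y0 x0) (s0 : Strip x0 x1)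
    (s1 : Strip x1 x2)
    (hd : ∀ p, ps x2 (p + 1) + ps x0 p + k1 ≤ ps x1 (p + 1) + ps x1 p + k0) (p : ℕ) :
    ps (op (op y0 x0 x1) x1 x2) (p + 1) + ps y0 p + k1 ≤
      ps (op y0 x0 x1) (p + 1) + ps (op y0 x0 x1) p + k0 := by
  have t1 := op_strip t0 s0
  have h1 := op_oct t1.2 s1 p
  have h2 := op_ge t0 s0 p
  have h3 := op_ge2 t0 s0 p
  have h4 := hd p
  have h5 := hd (p+1)
  have e : p + 1 + 1 = p + 2 := rfl
  simp only [e] at *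
  omega

/-- Truncation. -/
def trunc (i : ℕ) (f : ℕ → ℕ) : ℕ → ℕ := fun p => if p < i then f p else 0

lemma trunc_strip {f : ℕ → ℕ} (hf : ∀ p, f (p + 1) ≤ f p) (i : ℕ) :
    Strip (trunc i f) (trunc (i + 1) f) := by
  refine ⟨fun p => ?_, fun p => ?_⟩
  · simp only [trunc]; split_ifs <;> omega
  · have := hf p
    simp only [trunc]; split_ifs <;> omega

lemma ps_trunc (f : ℕ → ℕ) (i p : ℕ) : ps (trunc i f) p = ps f (min i p) := by
  induction p with
  | zero => simp [ps_zero]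
  | succ p ih =>
    rw [ps_succ, ih]
    simp only [trunc]
    split_ifs with h
    · rw [min_eq_right (by omega), min_eq_right (by omega), ps_succ]
    · rw [min_eq_left (by omega), min_eq_left (by omega)]; rfl

lemma trunc_bal {f : ℕ → ℕ} (hf : ∀ p, f (p + 1) ≤ f p) (i : ℕ) :
    Bal (trunc i f) (trunc (i + 1) f) (trunc (i + 2) f) := by
  intro p
  simp only [ps_trunc]
  rcases lt_trichotomy p (i+1) with h | h | h
  · rw [min_eq_right (by omega : p + 1 ≤ i + 2), min_eq_right (by omega : p ≤ i),
      min_eq_right (by omega : p + 1 ≤ i + 1), min_eq_right (by omega : p ≤ i + 1)]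
  · subst h
    simp only [min_eq_right (le_refl _), min_eq_left (by omega : i ≤ i + 1),
      min_eq_left (by omega : i + 1 ≤ i + 1 + 1)]
    have := hf i
    have h1 := ps_succ f i
    have h2 := ps_succ f (i+1)
    have e : i + 1 + 1 = i + 2 := rfl
    simp only [e] at *
    omega
  · rw [min_eq_left (by omega : i + 2 ≤ p + 1), min_eq_left (by omega : i ≤ p),
      min_eq_left (by omega : i + 1 ≤ p + 1), min_eq_left (by omega : i + 1 ≤ p)]
    have := hf i
    have h1 := ps_succ f i
    have h2 := ps_succ f (i+1)
    have e : i + 1 + 1 = i + 2 := rfl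
    simp only [e] at *
    omega

/-- One row of the switching diagram. -/
def rowOp (y0 : ℕ → ℕ) (x : ℕ → ℕ → ℕ) : ℕ → ℕ → ℕ
  | 0 => y0
  | j + 1 => op (rowOp y0 x j) (x j) (x (j + 1))

/-- The switching diagram. -/
def sw (N : ℕ) (S : ℕ → ℕ → ℕ) : ℕ → ℕ → ℕ → ℕ
  | 0 => S
  | t + 1 => rowOp (trunc (N - (t + 1)) (S 0)) (sw N S t)

lemma switch {S : ℕ → ℕ → ℕ} {κ lam : ℕ → ℕ} {N : ℕ}
    (hs : ∀ j, Strip (S j) (S (j + 1)))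
    (hz : ∀ j p, N ≤ p → S j p = 0)
    (hN : ∀ j, N ≤ j → S j = S N)
    (hκ : ∀ j, N ≤ j → κ j = 0)
    (hd : ∀ j p, ps (S (j + 2)) (p + 1) + ps (S j) p + κ (j + 1) ≤
      ps (S (j + 1)) (p + 1) + ps (S (j + 1)) p + κ j)
    (hl : ∀ j, lam j + ps (S j) N = κ j + ps (S (j + 1)) N) :
    ∃ β, LRChain β (S 0) (S N) ∧ LRChain κ β lam := by
  have hpart : ∀ j p, S j (p + 1) ≤ S j p := fun j p =>
    ((hs j).1 (p+1)).trans ((hs j).2 p)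
  have hS0 : trunc N (S 0) = S 0 := by
    funext p; simp only [trunc]; split_ifs with h
    · rfl
    · rw [hz 0 p (by omega)]
  set R := sw N S with hR
  have R0 : ∀ j, R 0 j = S j := fun j => rfl
  have Rt0 : ∀ t, R t 0 = trunc (N - t) (S 0) := by
    intro t
    cases t with
    | zero => simp [hS0, R0]
    | succ t => rfl
  have Rs : ∀ t j, R (t+1) (j+1) = op (R (t+1) j) (R t j) (R t (j+1)) := fun t j => rfl
  have key : ∀ t, t ≤ N → (∀ j, Strip (R t j) (R t (j+1))) ∧
      (∀ t', t' + 1 = t → ∀ j, Strip (R t j) (R t' j)) := by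
    intro t
    induction t with
    | zero => intro _; exact ⟨hs, by intros; omega⟩
    | succ t ih =>
      intro ht
      obtain ⟨ih1, -⟩ := ih (by omega)
      have h2 : ∀ j, Strip (R (t+1) j) (R t j) := by
        intro j
        induction j with
        | zero =>
          rw [Rt0, Rt0]
          have : N - t = N - (t+1) + 1 := by omega
          rw [this]; exact trunc_strip (hpart 0) _
        | succ j ihj => rw [Rs]; exact (op_strip ihj (ih1 j)).2
      refine ⟨fun j => ?_, fun t' ht' => ?_⟩
      · rw [Rs]; exact (op_strip (h2 j) (ih1 j)).1
      · obtain rfl : t' = t := by omega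
        exact h2
  have hh : ∀ t, t ≤ N → ∀ j, Strip (R t j) (R t (j+1)) := fun t ht => (key t ht).1
  have hv : ∀ t, t + 1 ≤ N → ∀ j, Strip (R (t+1) j) (R t j) := fun t ht => (key (t+1) ht).2 t rfl
  have zer : ∀ t, t ≤ N → ∀ j p, N ≤ p → R t j p = 0 := by
    intro t
    induction t with
    | zero => intro _; exact hz
    | succ t ih =>
      intro ht j p hp
      have := (hv t ht j).1 p
      rw [ih (by omega) j p hp] at this; omega
  have stab : ∀ t, t ≤ N → ∀ j, N ≤ j → R t (j+1) = R t j := by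
    intro t
    induction t with
    | zero => intro _ j hj; rw [R0, R0, hN j hj, hN (j+1) (by omega)]
    | succ t ih =>
      intro ht j hj
      rw [Rs, ih (by omega) j hj]; exact op_same (hv t ht j)
  have stab' : ∀ t, t ≤ N → ∀ j, N ≤ j → R t j = R t N := by
    intro t ht j hj
    induction j, hj using Nat.le_induction with
    | base => rfl
    | succ j hj ih => rw [stab t ht j hj, ih]
  have bal : ∀ t, t + 2 ≤ N → ∀ j, Bal (R (t+2) j) (R (t+1) j) (R t j) := by
    intro t ht j
    induction j with
    | zero =>
      rw [Rt0, Rt0, Rt0]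
      have e1 : N - t = N - (t+2) + 2 := by omega
      have e2 : N - (t+1) = N - (t+2) + 1 := by omega
      rw [e1, e2]; exact trunc_bal (hpart 0) _
    | succ j ih =>
      rw [Rs (t+1), Rs t]
      exact op_bal (hv (t+1) (by omega) j) (hv t (by omega) j) (hh t (by omega) j) ih
  have dom : ∀ t, t ≤ N → ∀ j p, ps (R t (j + 2)) (p + 1) + ps (R t j) p + κ (j + 1) ≤
      ps (R t (j + 1)) (p + 1) + ps (R t (j + 1)) p + κ j := by
    intro t
    induction t with
    | zero => intro _; exact hd
    | succ t ih =>
      intro ht j p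
      rw [Rs t (j+1), Rs t j]
      exact op_dom (hv t ht j) (hh t (by omega) j) (hh t (by omega) (j+1)) (ih (by omega) j) p
  have size : ∀ t, t + 1 ≤ N → ∀ j, ps (R (t+1) (j+1)) N + ps (R t j) N =
      ps (R (t+1) j) N + ps (R t (j+1)) N := by
    intro t ht j
    obtain ⟨N', hN'⟩ : ∃ N', N = N' + 1 := ⟨N - 1, by omega⟩
    have h := op_oct (hv t ht j) (hh t (by omega) j) N'
    rw [← Rs] at h
    have h1 := ps_stab (zer t (by omega) (j+1)) (N+1) (by omega)
    have h2 := ps_succ (R (t+1) j) N'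
    rw [hN'] at h1 ⊢
    have e : N' + 1 + 1 = N' + 2 := rfl
    simp only [e] at *
    omega
  have cont : ∀ t, t + 1 ≤ N → ∀ j, ps (R t j) N = ps (R (t+1) j) N + S 0 (N - (t+1)) := by
    intro t ht j
    induction j with
    | zero =>
      rw [Rt0, Rt0, ps_trunc, ps_trunc, min_eq_left (by omega), min_eq_left (by omega), ← ps_succ]
      congr 1; omega
    | succ j ih => have := size t ht j; omega
  have cont2 : ∀ t, t ≤ N → ∀ j, ps (R t (j+1)) N + ps (S j) N = ps (R t j) N + ps (S (j+1)) N := by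
    intro t
    induction t with
    | zero => intro _ j; rw [R0, R0]; omega
    | succ t ih =>
      intro ht j
      have := ih (by omega) j
      have := size t ht j
      omega
  refine ⟨R N N, ⟨fun e => R (N - e) N, N, rfl, ?_, ?_, ?_, ?_, ?_⟩, ?_⟩
  · intro e he; simp only [Nat.sub_eq_zero_of_le he, R0]
  · intro e p hp; exact zer _ (by omega) _ _ hp
  · intro e
    rcases lt_or_ge e N with h | h
    · have e1 : N - e = N - (e+1) + 1 := by omega
      simp only [e1]; exact hv _ (by omega) _
    · simp only [Nat.sub_eq_zero_of_le h, Nat.sub_eq_zero_of_le (by omega : N ≤ e + 1), R0]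
      exact ⟨fun p => le_rfl, fun p => hpart _ _⟩
  · intro e
    rcases lt_or_ge (e+1) N with h | h
    · have e1 : N - e = N - (e+2) + 2 := by omega
      have e2 : N - (e+1) = N - (e+2) + 1 := by omega
      simp only [e1, e2]; exact bal _ (by omega) _
    · simp only [Nat.sub_eq_zero_of_le h, Nat.sub_eq_zero_of_le (by omega : N ≤ e + 2)]
      intro p
      have : ∀ q, R (N - e) N q ≤ R 0 N q := by
        rcases lt_or_ge e N with h' | h'
        · have : N - e = 0 + 1 := by omega
          rw [this]; exact (hv 0 (by omega) N).1
        · rw [Nat.sub_eq_zero_of_le h']; exact fun q => le_rfl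
      have := ps_mono this p
      omega
  · intro e
    rcases lt_or_ge e N with h | h
    · have e1 : N - e = N - (e+1) + 1 := by omega
      have := cont (N - (e+1)) (by omega) N
      simp only [e1]
      rw [this]
      congr 2; omega
    · simp only [Nat.sub_eq_zero_of_le h, Nat.sub_eq_zero_of_le (by omega : N ≤ e + 1)]
      rw [hz 0 e h]; rfl
  · have Q0 : ∀ e, ps (R N 0) e = 0 := by
      intro e; rw [Rt0, ps_trunc]; simp [ps_zero]
    have Qs := hh N le_rfl
    have Qm : ∀ p e, ps (R N p) e ≤ ps (R N (p+1)) e := fun p e => ps_mono (Qs p).1 e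
    have tel : ∀ e p, ps (fun p => κ p + (ps (R N (p+1)) e - ps (R N p) e)) p =
        ps κ p + ps (R N p) e := by
      intro e p
      induction p with
      | zero => simp [ps_zero, Q0]
      | succ p ih => rw [ps_succ, ih, ps_succ]; have := Qm p e; omega
    refine ⟨fun e p => κ p + (ps (R N (p+1)) e - ps (R N p) e), N, ?_, ?_, ?_, ?_, ?_, ?_⟩
    · funext p; simp [ps_zero]
    · intro e he
      funext p
      beta_reduce
      rw [ps_stab (zer N le_rfl _) e he, ps_stab (zer N le_rfl _) e he]
      have := cont2 N le_rfl p
      have := hl p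
      have := Qm p N
      omega
    · intro e p hp
      beta_reduce
      rw [hκ p hp, stab N le_rfl p hp]; omega
    · intro e
      refine ⟨fun p => ?_, fun p => ?_⟩
      · have := (Qs p).1 e
        beta_reduce
        rw [ps_succ, ps_succ]; have := Qm p e; omega
      · have := dom N le_rfl p e
        have := Qm p e
        have := Qm (p+1) (e+1)
        have e : p + 1 + 1 = p + 2 := rfl
        simp only [e] at *
        omega
    · intro e p
      rw [tel, tel, tel, tel]
      have h1 := ps_succ (R N (p+1)) (e+1)
      have h2 := ps_succ (R N p) e
      have h3 := (Qs p).2 e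
      have e : e + 1 + 1 = e + 2 := rfl
      simp only [e] at *
      omega
    · intro e
      rw [tel, tel, ps_succ]; omega
lemma ncard_rows (f g : ℕ → ℕ) (P : ℕ) (h : ∀ p, f p ≤ g p) :
    {x : ℕ × ℕ | x.1 < P ∧ f x.1 ≤ x.2 ∧ x.2 < g x.1}.ncard + ps f P = ps g P ∧
    {x : ℕ × ℕ | x.1 < P ∧ f x.1 ≤ x.2 ∧ x.2 < g x.1}.Finite := by
  have hset : {x : ℕ × ℕ | x.1 < P ∧ f x.1 ≤ x.2 ∧ x.2 < g x.1} =
      (((Finset.range P).sigma fun p => Finset.Ico (f p) (g p)).map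
        (Equiv.sigmaEquivProd ℕ ℕ).toEmbedding : Finset (ℕ × ℕ)) := by
    ext ⟨a, b⟩
    simp only [Set.mem_setOf_eq, Finset.coe_map, Set.mem_image, Finset.mem_coe, Finset.mem_sigma,
      Finset.mem_range, Finset.mem_Ico]
    constructor
    · intro h
      exact ⟨⟨a, b⟩, ⟨h.1, h.2.1, h.2.2⟩, rfl⟩
    · rintro ⟨⟨a', b'⟩, h, he⟩
      simp only [Equiv.coe_toEmbedding, Equiv.sigmaEquivProd_apply, Prod.mk.injEq] at he
      obtain ⟨rfl, rfl⟩ := he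
      exact ⟨h.1, h.2.1, h.2.2⟩
  rw [hset]
  refine ⟨?_, Finset.finite_toSet _⟩
  rw [Set.ncard_coe_finset, Finset.card_map, Finset.card_sigma]
  simp only [Nat.card_Ico, ps]
  rw [← Finset.sum_add_distrib]
  exact Finset.sum_congr rfl fun q _ => by have := h q; omega

lemma tab_to_chain {lam mu nu : ℕ → ℕ} {T : ℕ → ℕ → ℕ} (h : IsLRTableau lam mu nu T) :
    LRChain lam mu nu := by
  obtain ⟨⟨hlam, N1, hN1⟩, ⟨hmu, N2, hN2⟩, ⟨hnu, N3, hN3⟩, hle, hoff, hon, hrow, hcol, hcont, hbal⟩ := h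
  set S : ℕ → ℕ → ℕ := fun e p =>
    lam p + ((Finset.Ico (lam p) (nu p)).filter (fun j => T p j ≤ e)).card with hS
  have Slam : ∀ e p, lam p ≤ S e p := fun e p => Nat.le_add_right _ _
  have Snu : ∀ e p, S e p ≤ nu p := by
    intro e p
    have := Finset.card_filter_le (Finset.Ico (lam p) (nu p)) (fun j => T p j ≤ e)
    rw [Nat.card_Ico] at this
    have := hle p
    simp only [hS]; omega
  have key : ∀ e p j, InSkew lam nu p j → (T p j ≤ e ↔ j < S e p) := by
    intro e p j hj
    constructor
    · intro hT
      have hsub : Finset.Icc (lam p) j ⊆ (Finset.Ico (lam p) (nu p)).filter (fun j => T p j ≤ e) := by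
        intro i hi
        rw [Finset.mem_Icc] at hi
        rw [Finset.mem_filter, Finset.mem_Ico]
        have hi' : InSkew lam nu p i := ⟨hi.1, by have := hj.2; omega⟩
        exact ⟨hi', (hrow p i j hi' hj hi.2).trans hT⟩
      have := Finset.card_le_card hsub
      rw [Nat.card_Icc] at this
      have := hj.1
      simp only [hS]; omega
    · intro hlt
      by_contra hT
      have hsub : (Finset.Ico (lam p) (nu p)).filter (fun j => T p j ≤ e) ⊆ Finset.Ico (lam p) j := by
        intro i hi
        rw [Finset.mem_filter, Finset.mem_Ico] at hi
        rw [Finset.mem_Ico]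
        refine ⟨hi.1.1, ?_⟩
        by_contra hij
        have := hrow p j i hj hi.1 (by omega)
        omega
      have := Finset.card_le_card hsub
      rw [Nat.card_Ico] at this
      have := hj.1
      simp only [hS] at hlt; omega
  have Smono : ∀ e p, S e p ≤ S (e+1) p := by
    intro e p
    simp only [hS]
    have : (Finset.Ico (lam p) (nu p)).filter (fun j => T p j ≤ e) ⊆
      (Finset.Ico (lam p) (nu p)).filter (fun j => T p j ≤ e + 1) := by
      intro i hi
      rw [Finset.mem_filter] at hi ⊢
      exact ⟨hi.1, by omega⟩
    have := Finset.card_le_card this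
    omega
  have val : ∀ e p j, (InSkew lam nu p j ∧ T p j = e + 1) ↔ (S e p ≤ j ∧ j < S (e+1) p) := by
    intro e p j
    constructor
    · rintro ⟨hj, hT⟩
      have h1 := key e p j hj
      have h2 := key (e+1) p j hj
      omega
    · rintro ⟨h1, h2⟩
      have hj : InSkew lam nu p j := ⟨(Slam e p).trans h1, by have := Snu (e+1) p; omega⟩
      refine ⟨hj, ?_⟩
      have h3 := key e p j hj
      have h4 := key (e+1) p j hj
      omega
  have Sstrip : ∀ e, Strip (S e) (S (e+1)) := by
    intro e
    refine ⟨Smono e, fun p => ?_⟩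
    by_contra hcon
    push Not at hcon
    have h1 : InSkew lam nu (p+1) (S e p) :=
      ⟨(hlam p (p+1) (by omega)).trans (Slam e p), by have := Snu (e+1) (p+1); omega⟩
    have h2 : InSkew lam nu p (S e p) :=
      ⟨Slam e p, by have := h1.2; have := hnu p (p+1) (by omega); omega⟩
    have h3 := hcol p (p+1) (S e p) h2 h1 (by omega)
    have h4 := (key (e+1) (p+1) (S e p) h1).2 hcon
    have h5 := (key e p (S e p) h2).1 (by omega)
    omega
  have S0 : S 0 = lam := by
    funext p
    have : (Finset.Ico (lam p) (nu p)).filter (fun j => T p j ≤ 0) = ∅ := by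
      apply Finset.filter_eq_empty_iff.2
      intro j hj
      rw [Finset.mem_Ico] at hj
      have := hon p j hj
      omega
    simp only [hS, this]; simp
  have zer : ∀ e p, N3 ≤ p → S e p = 0 := by
    intro e p hp
    have := Snu e p
    rw [hN3 p hp] at this; omega
  have cont : ∀ e P, N3 ≤ P → ps (S (e+1)) P = ps (S e) P + mu e := by
    intro e P hP
    have h1 := (ncard_rows (S e) (S (e+1)) P (Smono e)).1
    have : {x : ℕ × ℕ | x.1 < P ∧ S e x.1 ≤ x.2 ∧ x.2 < S (e+1) x.1} =
        {p : ℕ × ℕ | InSkew lam nu p.1 p.2 ∧ T p.1 p.2 = e + 1} := by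
      ext ⟨a, b⟩
      simp only [Set.mem_setOf_eq, val]
      constructor
      · exact fun h => h.2
      · intro h
        refine ⟨?_, h⟩
        by_contra hc
        have := zer (e+1) a (by omega)
        omega
    rw [this, hcont e] at h1
    omega
  have top : ∀ e, N2 ≤ e → S e = nu := by
    intro e he
    funext p
    refine le_antisymm (Snu e p) ?_
    by_contra hc
    push Not at hc
    have hj : InSkew lam nu p (S e p) := ⟨Slam e p, hc⟩
    have h1 : ¬ T p (S e p) ≤ e := by rw [key e p _ hj]; omega
    obtain ⟨d, hd⟩ : ∃ d, T p (S e p) = d + 1 := ⟨T p (S e p) - 1, by omega⟩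
    have h2 := (val d p (S e p)).1 ⟨hj, hd⟩
    have h3 := cont d (max N3 (p+1)) (le_max_left _ _)
    rw [hN2 d (by omega)] at h3
    have h4 : ps (S d) (max N3 (p+1)) < ps (S (d+1)) (max N3 (p+1)) := by
      apply Finset.sum_lt_sum (fun q _ => Smono d q)
      exact ⟨p, Finset.mem_range.2 (by omega), by omega⟩
    omega
  have bal : ∀ e, Bal (S e) (S (e+1)) (S (e+2)) := by
    intro e p
    induction p with
    | zero =>
      simp only [ps_succ, ps_zero]
      by_contra hc
      have hj := (val (e+1) 0 (S (e+1) 0)).2 ⟨le_rfl, by simp only [add_assoc]; norm_num; omega⟩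
      have := hbal e (0, S (e+1) 0) hj.1 hj.2
      have hE : {p : ℕ × ℕ | InSkew lam nu p.1 p.2 ∧ T p.1 p.2 = e + 1 ∧
          ReadBefore p (0, S (e+1) 0)} = ∅ := by
        ext ⟨a, b⟩
        simp only [Set.mem_setOf_eq, ← and_assoc, val, ReadBefore, Set.mem_empty_iff_false, iff_false]
        rintro ⟨⟨h1, h2⟩, h3 | ⟨h3, h4⟩⟩
        · omega
        · subst h3; omega
      rw [hE, Set.ncard_empty] at this
      have hfin : {p : ℕ × ℕ | InSkew lam nu p.1 p.2 ∧ T p.1 p.2 = e + 2 ∧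
          ReadBefore p (0, S (e+1) 0)}.Finite := by
        apply (ncard_rows (S (e+1)) (S (e+2)) N3 (Smono (e+1))).2.subset
        rintro ⟨a, b⟩ ⟨h1, h2, -⟩
        have := (val (e+1) a b).1 ⟨h1, h2⟩
        refine ⟨?_, this⟩
        by_contra hc
        have := zer (e+1+1) a (by simpa using hc)
        omega
      have hne : (0, S (e+1) 0) ∈ {p : ℕ × ℕ | InSkew lam nu p.1 p.2 ∧ T p.1 p.2 = e + 2 ∧
          ReadBefore p (0, S (e+1) 0)} := ⟨hj.1, hj.2, Or.inr ⟨rfl, le_rfl⟩⟩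
      have := (Set.ncard_pos hfin).2 ⟨_, hne⟩
      omega
    | succ p ih =>
      by_cases hc : S (e+2) (p+1) ≤ S (e+1) (p+1)
      · rw [ps_succ _ (p+1), ps_succ (S (e+1)) (p+1)]
        have h1 := ps_succ (S e) p
        have h2 := ps_succ (S (e+1)) p
        have := Smono e p
        omega
      · have hj := (val (e+1) (p+1) (S (e+1) (p+1))).2 ⟨le_rfl, by simp only [add_assoc] at *; norm_num at *; omega⟩
        have hb := hbal e (p+1, S (e+1) (p+1)) hj.1 hj.2
        have hE : {x : ℕ × ℕ | InSkew lam nu x.1 x.2 ∧ T x.1 x.2 = e + 1 ∧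
            ReadBefore x (p+1, S (e+1) (p+1))} =
            {x : ℕ × ℕ | x.1 < p + 1 ∧ S e x.1 ≤ x.2 ∧ x.2 < S (e+1) x.1} := by
          ext ⟨a, b⟩
          simp only [Set.mem_setOf_eq, ← and_assoc, val, ReadBefore]
          constructor
          · rintro ⟨⟨h1, h2⟩, h3 | ⟨h3, h4⟩⟩
            · exact ⟨⟨h3, h1⟩, h2⟩
            · subst h3; omega
          · rintro ⟨⟨h1, h2⟩, h3⟩
            exact ⟨⟨h2, h3⟩, Or.inl h1⟩
        have hE2 : {x : ℕ × ℕ | InSkew lam nu x.1 x.2 ∧ T x.1 x.2 = e + 2 ∧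
            ReadBefore x (p+1, S (e+1) (p+1))} =
            {x : ℕ × ℕ | x.1 < p + 2 ∧ S (e+1) x.1 ≤ x.2 ∧ x.2 < S (e+2) x.1} := by
          ext ⟨a, b⟩
          have := val (e+1) a b
          simp only [Set.mem_setOf_eq, ← and_assoc, ReadBefore]
          rw [this]
          constructor
          · rintro ⟨⟨h1, h2⟩, h3 | ⟨h3, h4⟩⟩
            · exact ⟨⟨by omega, h1⟩, h2⟩
            · exact ⟨⟨by omega, h1⟩, h2⟩
          · rintro ⟨⟨h1, h2⟩, h3⟩
            refine ⟨⟨h2, h3⟩, ?_⟩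
            rcases Nat.lt_or_ge a (p+1) with h | h
            · exact Or.inl h
            · have : a = p + 1 := by omega
              subst this
              exact Or.inr ⟨rfl, h2⟩
        rw [hE, hE2] at hb
        have h1 := (ncard_rows (S e) (S (e+1)) (p+1) (Smono e)).1
        have h2 := (ncard_rows (S (e+1)) (S (e+2)) (p+2) (Smono (e+1))).1
        have e : p + 1 + 1 = p + 2 := rfl
        simp only [e] at *
        omega
  refine ⟨S, max N2 N3, S0, fun e he => top e (by omega), fun e p hp => zer e p (by omega),
    Sstrip, bal, fun e => cont e _ (by omega)⟩

lemma chain_to_tab {lam mu nu : ℕ → ℕ} (h : LRChain lam mu nu) :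
    ∃ T, IsLRTableau lam mu nu T := by
  obtain ⟨S, N, rfl, htop, zer, strip, bal, cont⟩ := h
  have part : ∀ e, IsPartition (S e) := by
    intro e
    refine ⟨fun i j hij => ?_, N, zer e⟩
    induction j, hij using Nat.le_induction with
    | base => rfl
    | succ j hj ih => exact (((strip e).1 (j+1)).trans ((strip e).2 j)).trans ih
  have Smono : ∀ p, Monotone fun e => S e p := fun p => monotone_nat_of_le_succ fun e => (strip e).1 p
  have hnu : S N = nu := htop N le_rfl
  have Snu : ∀ e p, S e p ≤ nu p := by
    intro e p
    have := Smono p (le_max_left e N)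
    simp only [htop (max e N) (le_max_right _ _)] at this
    exact this
  classical
  set T : ℕ → ℕ → ℕ := fun i j => if InSkew (S 0) nu i j then sInf {e | j < S e i} else 0 with hT
  have key : ∀ e p j, InSkew (S 0) nu p j → (T p j ≤ e ↔ j < S e p) := by
    intro e p j hj
    have hne : {e | j < S e p}.Nonempty := ⟨N, by
      show j < S N p
      rw [hnu]; exact hj.2⟩
    simp only [hT, if_pos hj]
    constructor
    · intro h
      have h1 : j < S (sInf {e | j < S e p}) p := Nat.sInf_mem hne
      exact lt_of_lt_of_le h1 (Smono p h)
    · intro h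
      exact Nat.sInf_le h
  have val : ∀ e p j, (InSkew (S 0) nu p j ∧ T p j = e + 1) ↔ (S e p ≤ j ∧ j < S (e+1) p) := by
    intro e p j
    constructor
    · rintro ⟨hj, hT⟩
      have h1 := key e p j hj
      have h2 := key (e+1) p j hj
      omega
    · rintro ⟨h1, h2⟩
      have hj : InSkew (S 0) nu p j := ⟨(Smono p (Nat.zero_le e)).trans h1, by have := Snu (e+1) p; omega⟩
      refine ⟨hj, ?_⟩
      have h3 := key e p j hj
      have h4 := key (e+1) p j hj
      omega
  have fin : ∀ e, {x : ℕ × ℕ | InSkew (S 0) nu x.1 x.2 ∧ T x.1 x.2 = e + 1} =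
      {x : ℕ × ℕ | x.1 < N ∧ S e x.1 ≤ x.2 ∧ x.2 < S (e+1) x.1} := by
    intro e
    ext ⟨a, b⟩
    simp only [Set.mem_setOf_eq, val]
    constructor
    · intro h
      refine ⟨?_, h⟩
      by_contra hc
      have := zer (e+1) a (by omega)
      omega
    · exact fun h => h.2
  refine ⟨T, part 0, ⟨fun i j hij => ?_, N, fun i hi => ?_⟩, hnu ▸ part N, Snu 0, ?_, ?_, ?_, ?_, ?_, ?_⟩
  · induction j, hij using Nat.le_induction with
    | base => rfl
    | succ j hj ih =>
      refine le_trans ?_ ih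
      have h1 := bal j N
      have h2 := cont j
      have h3 := cont (j+1)
      have h4 := ps_stab (zer (j+2)) (N+1) (by omega)
      have h5 := ps_stab (zer (j+1)) (N+1) (by omega)
      have e : j + 1 + 1 = j + 2 := rfl
      simp only [e] at *
      omega
  · have := cont i
    rw [htop i hi, htop (i+1) (by omega)] at this
    omega
  · intro i j hij; simp only [hT, if_neg hij]
  · intro i j hij
    have := key 0 i j hij
    have := hij.1
    omega
  · intro i j j' h1 h2 hjj
    rw [key _ _ _ h1]
    have := (key (T i j') i j' h2).1 le_rfl
    omega
  · intro i i' j h1 h2 hii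
    obtain ⟨d, hd⟩ : ∃ d, T i' j = d + 1 := by
      have := key 0 i' j h2
      have := h2.1
      exact ⟨T i' j - 1, by omega⟩
    have h3 := (val d i' j).1 ⟨h2, hd⟩
    have h4 : j < S d i := by
      have h5 := (strip d).2 (i' - 1)
      rw [Nat.sub_add_cancel (by omega)] at h5
      have h6 := (part d).1 i (i' - 1) (by omega)
      omega
    have := (key d i j h1).2 h4
    omega
  · intro e
    rw [fin e]
    have h1 := (ncard_rows (S e) (S (e+1)) N (strip e).1).1
    have := cont e
    omega
  · rintro k ⟨i, j⟩ hq hTq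
    have h1 := ncard_rows (S k) (S (k+1)) i (strip k).1
    have h2 := ncard_rows (S (k+1)) (S (k+2)) (i+1) (strip (k+1)).1
    have hb := bal k i
    have l1 : {p : ℕ × ℕ | InSkew (S 0) nu p.1 p.2 ∧ T p.1 p.2 = k + 2 ∧ ReadBefore p (i, j)}.ncard ≤
        {x : ℕ × ℕ | x.1 < i + 1 ∧ S (k+1) x.1 ≤ x.2 ∧ x.2 < S (k+2) x.1}.ncard := by
      apply Set.ncard_le_ncard _ h2.2
      rintro ⟨a, b⟩ ⟨h3, h4, h5⟩
      have h6 := (val (k+1) a b).1 ⟨h3, h4⟩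
      refine ⟨?_, h6⟩
      simp only [ReadBefore] at h5
      show a < i + 1
      omega
    have l2 : {x : ℕ × ℕ | x.1 < i ∧ S k x.1 ≤ x.2 ∧ x.2 < S (k+1) x.1}.ncard ≤
        {p : ℕ × ℕ | InSkew (S 0) nu p.1 p.2 ∧ T p.1 p.2 = k + 1 ∧ ReadBefore p (i, j)}.ncard := by
      apply Set.ncard_le_ncard
      · rintro ⟨a, b⟩ ⟨h3, h4⟩
        have := (val k a b).2 h4
        exact ⟨this.1, this.2, Or.inl h3⟩
      · apply (ncard_rows (S k) (S (k+1)) N (strip k).1).2.subset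
        rw [← fin k]
        exact fun x hx => ⟨hx.1, hx.2.1⟩
    omega

lemma finite_le (l : ℕ → ℕ) (hl : ∃ N, ∀ i, N ≤ i → l i = 0) : {a : ℕ → ℕ | ∀ i, a i ≤ l i}.Finite := by
  obtain ⟨N, hN⟩ := hl
  have : ({a : ℕ → ℕ | ∀ i, a i ≤ l i}).InjOn (fun a (i : Fin N) => a i) := by
    intro a ha b hb hab
    funext i
    by_cases hi : i < N
    · exact congrFun hab ⟨i, hi⟩
    · have h1 := ha i
      have h2 := hb i
      have := hN i (by omega)
      omega
  apply Set.Finite.of_finite_image _ this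
  apply (Set.finite_Iic (fun i : Fin N => l i)).subset
  rintro _ ⟨a, ha, rfl⟩
  exact fun i => ha i

lemma finite_tab (lam mu nu : ℕ → ℕ) : Finite {T : ℕ → ℕ → ℕ // IsLRTableau lam mu nu T} := by
  by_cases hp : IsPartition mu ∧ IsPartition nu
  · obtain ⟨⟨-, N2, hN2⟩, ⟨hnu, N3, hN3⟩⟩ := hp
    let M := max N2 (max N3 (nu 0))
    let b : ℕ × ℕ → ℕ := fun x => if x.1 < M ∧ x.2 < M then M + 1 else 0
    have hsup : ∀ T, IsLRTableau lam mu nu T → ∀ i j, T i j ≤ b (i, j) := by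
      intro T hT i j
      obtain ⟨-, -, -, -, hoff, -, -, -, hcont, -⟩ := hT
      by_cases hij : InSkew lam nu i j
      · have h1 : i < N3 := by
          by_contra hc
          have := hN3 i (by omega)
          have := hij.2
          omega
        have h2 : j < nu 0 := lt_of_lt_of_le hij.2 (hnu 0 i (by omega))
        have : b (i, j) = M + 1 := if_pos ⟨by show i < M; omega, by show j < M; omega⟩
        rw [this]
        by_contra hc
        obtain ⟨d, hd⟩ : ∃ d, T i j = d + 1 := ⟨T i j - 1, by omega⟩
        have h3 := hcont d
        rw [hN2 d (by omega)] at h3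
        have hfin : {p : ℕ × ℕ | InSkew lam nu p.1 p.2 ∧ T p.1 p.2 = d + 1}.Finite := by
          apply ((Set.finite_Iio N3).prod (Set.finite_Iio (nu 0))).subset
          rintro ⟨a, c⟩ ⟨h4, -⟩
          refine ⟨?_, lt_of_lt_of_le h4.2 (hnu 0 a (by omega))⟩
          show a < N3
          by_contra hc
          have := hN3 a (by omega)
          have : c < nu a := h4.2
          omega
        rw [Set.ncard_eq_zero hfin] at h3
        have : (i, j) ∈ {p : ℕ × ℕ | InSkew lam nu p.1 p.2 ∧ T p.1 p.2 = d + 1} := ⟨hij, hd⟩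
        rw [h3] at this
        exact this
      · rw [hoff i j hij]; omega
    let φ : {T : ℕ → ℕ → ℕ // IsLRTableau lam mu nu T} → (Fin M → Fin M → Fin (M + 2)) :=
      fun T i j => ⟨T.1 i j, by
        have := hsup T.1 T.2 i j
        have : b (i, j) ≤ M + 1 := by simp only [b]; split_ifs <;> omega
        omega⟩
    apply Finite.of_injective φ
    rintro ⟨T, hT⟩ ⟨T', hT'⟩ h
    apply Subtype.ext
    funext i j
    by_cases hij : i < M ∧ j < M
    · have := congrArg Fin.val (congrFun (congrFun h ⟨i, hij.1⟩) ⟨j, hij.2⟩)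
      exact this
    · have hb : b (i, j) = 0 := if_neg hij
      have h1 := hsup T hT i j
      have h2 := hsup T' hT' i j
      show T i j = T' i j
      omega
  · have : IsEmpty {T : ℕ → ℕ → ℕ // IsLRTableau lam mu nu T} :=
      ⟨fun T => hp ⟨T.2.2.1, T.2.2.2.1⟩⟩
    infer_instance

lemma lr_pos_iff (lam mu nu : ℕ → ℕ) : 0 < lrCoeff lam mu nu ↔ LRChain lam mu nu := by
  have := finite_tab lam mu nu
  rw [lrCoeff, Nat.card_pos_iff]
  constructor
  · rintro ⟨⟨T, hT⟩, -⟩; exact tab_to_chain hT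
  · intro h
    obtain ⟨T, hT⟩ := chain_to_tab h
    exact ⟨⟨T, hT⟩, this⟩

lemma lr_ne_zero_le {lam mu nu : ℕ → ℕ} (h : lrCoeff lam mu nu ≠ 0) : ∀ i, lam i ≤ nu i := by
  obtain ⟨S, N, rfl, htop, -, strip, -, -⟩ := (lr_pos_iff _ _ _).1 (Nat.pos_of_ne_zero h)
  intro i
  have : Monotone fun e => S e i := monotone_nat_of_le_succ fun e => (strip e).1 i
  have := this (Nat.zero_le N)
  simp only [htop N le_rfl] at this
  exact this

lemma finsum_pos_nat {f : (ℕ → ℕ) → ℕ} {l : ℕ → ℕ} (hl : ∃ N, ∀ i, N ≤ i → l i = 0)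
    (hs : ∀ a, f a ≠ 0 → ∀ i, a i ≤ l i) (a : ℕ → ℕ) (ha : 0 < f a) : 0 < ∑ᶠ x, f x := by
  have hfin : (Function.support f).Finite := (finite_le l hl).subset fun a h => hs a h
  exact lt_of_lt_of_le ha (single_le_finsum a hfin fun _ => Nat.zero_le _)

lemma NL6_pos {l1 l2 l3 l4 l5 l6 a1 a2 a3 a4 a5 a6 : ℕ → ℕ}
    (h1 : LRChain a1 a2 l1) (h2 : LRChain a2 a3 l2) (h3 : LRChain a3 a4 l3)
    (h4 : LRChain a4 a5 l4) (h5 : LRChain a5 a6 l5) (h6 : LRChain a6 a1 l6) :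
    0 < NL6 l1 l2 l3 l4 l5 l6 := by
  have fz : ∀ {a b l : ℕ → ℕ}, LRChain a b l → ∃ N, ∀ i, N ≤ i → l i = 0 := by
    rintro a b l ⟨S, N, -, htop, zer, -⟩
    refine ⟨N, fun i hi => ?_⟩
    rw [← htop N le_rfl]; exact zer N i hi
  have nz : ∀ {f : (ℕ → ℕ) → ℕ}, (∑ᶠ x, f x) ≠ 0 → ∃ x, f x ≠ 0 :=
    fun h => by
      by_contra hc
      push Not at hc
      exact h (by simp [hc])
  unfold NL6
  refine finsum_pos_nat (fz h1) (fun b1 hb => ?_) a1 ?_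
  · obtain ⟨b2, hb⟩ := nz hb
    obtain ⟨b3, hb⟩ := nz hb
    obtain ⟨b4, hb⟩ := nz hb
    obtain ⟨b5, hb⟩ := nz hb
    obtain ⟨b6, hb⟩ := nz hb
    simp only [mul_ne_zero_iff] at hb
    exact lr_ne_zero_le hb.1.1.1.1.1
  refine finsum_pos_nat (fz h2) (fun b2 hb => ?_) a2 ?_
  · obtain ⟨b3, hb⟩ := nz hb
    obtain ⟨b4, hb⟩ := nz hb
    obtain ⟨b5, hb⟩ := nz hb
    obtain ⟨b6, hb⟩ := nz hb
    simp only [mul_ne_zero_iff] at hb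
    exact lr_ne_zero_le hb.1.1.1.1.2
  refine finsum_pos_nat (fz h3) (fun b3 hb => ?_) a3 ?_
  · obtain ⟨b4, hb⟩ := nz hb
    obtain ⟨b5, hb⟩ := nz hb
    obtain ⟨b6, hb⟩ := nz hb
    simp only [mul_ne_zero_iff] at hb
    exact lr_ne_zero_le hb.1.1.1.2
  refine finsum_pos_nat (fz h4) (fun b4 hb => ?_) a4 ?_
  · obtain ⟨b5, hb⟩ := nz hb
    obtain ⟨b6, hb⟩ := nz hb
    simp only [mul_ne_zero_iff] at hb
    exact lr_ne_zero_le hb.1.1.2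
  refine finsum_pos_nat (fz h5) (fun b5 hb => ?_) a5 ?_
  · obtain ⟨b6, hb⟩ := nz hb
    simp only [mul_ne_zero_iff] at hb
    exact lr_ne_zero_le hb.1.2
  refine finsum_pos_nat (fz h6) (fun b6 hb => ?_) a6 ?_
  · simp only [mul_ne_zero_iff] at hb
    exact lr_ne_zero_le hb.2
  rw [← lr_pos_iff] at h1 h2 h3 h4 h5 h6
  positivity

lemma rows_const {S : ℕ → ℕ → ℕ} (hs : ∀ e, Strip (S e) (S (e + 1)))
    (hb : ∀ e, Bal (S e) (S (e + 1)) (S (e + 2))) :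
    ∀ e p, p ≤ e → ps (S (e + 1)) p = ps (S e) p := by
  intro e
  induction e with
  | zero =>
    intro p hp
    obtain rfl : p = 0 := by omega
    simp [ps_zero]
  | succ e ih =>
    intro p hp
    cases p with
    | zero => simp [ps_zero]
    | succ p =>
      have h1 := hb e p
      have h2 := ih p (by omega)
      have h3 := ps_mono (hs (e+1)).1 (p+1)
      have e1 : e + 1 + 1 = e + 2 := rfl
      simp only [e1] at *
      omega

lemma rows_top {S : ℕ → ℕ → ℕ} {nu : ℕ → ℕ} {N : ℕ} (hs : ∀ e, Strip (S e) (S (e + 1)))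
    (hb : ∀ e, Bal (S e) (S (e + 1)) (S (e + 2))) (ht : ∀ e, N ≤ e → S e = nu) (p e : ℕ)
    (h : p ≤ e) : ps (S e) p = ps nu p := by
  have key : ∀ d, ps (S (e + d)) p = ps (S e) p := by
    intro d
    induction d with
    | zero => rfl
    | succ d ih => rw [← ih]; exact rows_const hs hb (e+d) p (by omega)
  rw [← key N, ht _ (by omega)]

lemma chain_zero {β nu : ℕ → ℕ} (h : LRChain (fun _ => 0) β nu) : β = nu := by
  obtain ⟨S, N, h0, ht, hz, hs, hb, hcont⟩ := h
  have z : ∀ e p, e ≤ p → S e p = 0 := by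
    intro e
    induction e with
    | zero => intro p _; rw [h0]
    | succ e ih =>
      intro p hp
      obtain ⟨q, rfl⟩ : ∃ q, p = q + 1 := ⟨p - 1, by omega⟩
      have := (hs e).2 q
      have := ih q (by omega)
      omega
  have sz : ∀ e, ps (S e) N = ps nu e := by
    intro e
    rw [← rows_top hs hb ht e e le_rfl]
    rcases le_total e N with h | h
    · exact ps_stab (z e) N h
    · exact (ps_stab (hz e) e h).symm
  funext e
  have := hcont e
  rw [sz, sz, ps_succ] at this
  omega

lemma chain_comm {lam mu nu : ℕ → ℕ} (h : LRChain lam mu nu) : LRChain mu lam nu := by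
  obtain ⟨S, N, h0, ht, hz, hs, hb, hcont⟩ := h
  obtain ⟨β, h1, h2⟩ := switch (S := S) (κ := fun _ => 0) (lam := mu) (N := N) hs hz
    (fun j hj => by rw [ht j hj, ht N le_rfl]) (fun _ _ => rfl)
    (fun j p => by have := hb j p; omega) (fun j => by have := hcont j; omega)
  rw [chain_zero h2, h0, ht N le_rfl] at h1
  exact h1

/-- Hives with boundary `U, V, W`. -/
structure Hive (r k : ℕ) (U V W : ℕ → ℕ) (g : ℕ → ℕ → ℕ → ℤ) : Prop where
  eU : ∀ y z, y + 1 + z = r → g 0 (y + 1) z - g 0 y (z + 1) = U y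
  eV : ∀ x y, x + 1 + y = r → g (x + 1) y 0 - g x (y + 1) 0 = V x
  eW : ∀ x z, x + 1 + z = r → g x 0 (z + 1) - g (x + 1) 0 z = W z - k
  R1 : ∀ x y z, x + y + z + 2 = r →
    g (x + 2) y z + g x (y + 1) (z + 1) ≤ g (x + 1) (y + 1) z + g (x + 1) y (z + 1)
  R2 : ∀ x y z, x + y + z + 2 = r →
    g x (y + 2) z + g (x + 1) y (z + 1) ≤ g x (y + 1) (z + 1) + g (x + 1) (y + 1) z
  R3 : ∀ x y z, x + y + z + 2 = r →
    g x y (z + 2) + g (x + 1) (y + 1) z ≤ g (x + 1) y (z + 1) + g x (y + 1) (z + 1)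

/-- Rotation of a hive. -/
def rot (k : ℕ) (g : ℕ → ℕ → ℕ → ℤ) : ℕ → ℕ → ℕ → ℤ := fun x y z => g y z x + k * x

lemma Hive.rot {r k : ℕ} {U V W : ℕ → ℕ} {g : ℕ → ℕ → ℕ → ℤ} (h : Hive r k U V W g) :
    Hive r k V W U (rot k g) where
  eU y z e := by
    have := h.eV y z e
    simp only [_root_.rot]; push_cast; linarith
  eV x y e := by
    have := h.eW y x (by omega)
    simp only [_root_.rot]; push_cast; linarith
  eW x z e := by
    have := h.eU z x (by omega)
    simp only [_root_.rot]; push_cast; linarith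
  R1 x y z e := by
    have := h.R3 y z x (by omega)
    simp only [_root_.rot]; push_cast; linarith
  R2 x y z e := by
    have := h.R1 y z x (by omega)
    simp only [_root_.rot]; push_cast; linarith
  R3 x y z e := by
    have := h.R2 y z x (by omega)
    simp only [_root_.rot]; push_cast; linarith

lemma hive_of_chain {r k : ℕ} {U V W : ℕ → ℕ} (hW : ∀ i, W i ≤ k)
    (h : LRChain U V (compP k r W)) : ∃ g, Hive r k U V W g := by
  obtain ⟨S, N, h0, ht, hz, hs, hb, hcont⟩ := h
  have mono : ∀ e p, S e p ≤ compP k r W p := by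
    intro e p
    have : Monotone fun e => S e p := monotone_nat_of_le_succ fun e => (hs e).1 p
    have := this (Nat.le_add_right e N)
    simp only [ht (e + N) (by omega)] at this
    exact this
  have zr : ∀ e p, r ≤ p → S e p = 0 := by
    intro e p hp
    have := mono e p
    simp only [compP, if_neg (show ¬ p < r by omega)] at this
    omega
  have sz : ∀ e, ps (S e) N = ps (S e) r := by
    intro e
    rcases le_total r N with h | h
    · exact ps_stab (zr e) N h
    · exact (ps_stab (hz e) r h).symm
  refine ⟨fun x y _ => (ps (S x) (x + y) : ℤ), ?_, ?_, ?_, ?_, ?_, ?_⟩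
  · intro y z e
    simp only [zero_add, ps_succ, h0]
    push_cast; ring
  · intro x y e
    have e1 : x + 1 + y = r := e
    have e2 : x + (y + 1) = r := by omega
    have := hcont x
    simp only [sz] at this
    simp only [e1, e2, this]
    push_cast; ring
  · intro x z e
    simp only [add_zero]
    rw [rows_top hs hb ht x x le_rfl, rows_top hs hb ht (x+1) (x+1) le_rfl, ps_succ]
    have : compP k r W x = k - W z := by
      simp only [compP, if_pos (show x < r by omega)]
      congr 2; omega
    have := hW z
    omega
  · intro x y z e
    have := hb x (x + y + 1)
    have e1 : x + 2 + y = x + y + 1 + 1 := by omega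
    have e2 : x + (y + 1) = x + y + 1 := by omega
    have e3 : x + 1 + (y + 1) = x + y + 1 + 1 := by omega
    have e4 : x + 1 + y = x + y + 1 := by omega
    simp only [e1, e2, e3, e4]
    omega
  · intro x y z e
    have := (hs x).1 (x + y + 1)
    have e1 : x + (y + 2) = x + y + 1 + 1 := by omega
    have e2 : x + (y + 1) = x + y + 1 := by omega
    have e3 : x + 1 + (y + 1) = x + y + 1 + 1 := by omega
    have e4 : x + 1 + y = x + y + 1 := by omega
    simp only [e1, e2, e3, e4]
    rw [ps_succ (S x) (x+y+1), ps_succ (S (x+1)) (x+y+1)]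
    push_cast; omega
  · intro x y z e
    have := (hs x).2 (x + y)
    have e2 : x + (y + 1) = x + y + 1 := by omega
    have e3 : x + 1 + (y + 1) = x + y + 1 + 1 := by omega
    have e4 : x + 1 + y = x + y + 1 := by omega
    simp only [e2, e3, e4]
    rw [ps_succ (S x) (x+y), ps_succ (S (x+1)) (x+y+1)]
    push_cast; omega

/-- Row differences of a hive. -/
def Qd (r : ℕ) (g : ℕ → ℕ → ℕ → ℤ) (b x p : ℕ) : ℤ :=
  g x (b + p + 1) (r - x - b - p - 1) - g x (b + p) (r - x - b - p)

/-- Rows of a hive. -/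
def Qf (r : ℕ) (g : ℕ → ℕ → ℕ → ℤ) (b x p : ℕ) : ℕ :=
  if x + b + p < r then (Qd r g b x p).toNat else 0

/-- Left side of a trapezoid. -/
def kap (r k : ℕ) (g : ℕ → ℕ → ℕ → ℤ) (a b j : ℕ) : ℕ :=
  if j < a then (g (a - j - 1) b (r - (a - j - 1) - b) - g (a - j) b (r - (a - j) - b) + k).toNat
  else 0

lemma Qd_R2 {r k : ℕ} {U V W : ℕ → ℕ} {g : ℕ → ℕ → ℕ → ℤ} (h : Hive r k U V W g) (b x p : ℕ)
    (hp : x + b + p + 2 ≤ r) : Qd r g b x (p + 1) ≤ Qd r g b (x + 1) p := by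
  obtain ⟨z, rfl⟩ : ∃ z, r = x + (b + p) + z + 2 := ⟨r - (x + (b+p) + 2), by omega⟩
  have := h.R2 x (b + p) z rfl
  unfold Qd
  rw [show x + (b + p) + z + 2 - x - b - (p + 1) - 1 = z by omega,
    show x + (b + p) + z + 2 - x - b - (p + 1) = z + 1 by omega,
    show x + (b + p) + z + 2 - (x + 1) - b - p - 1 = z by omega,
    show x + (b + p) + z + 2 - (x + 1) - b - p = z + 1 by omega,
    show b + (p + 1) + 1 = b + p + 2 by omega, show b + (p + 1) = b + p + 1 by omega]
  linarith

lemma Qd_R3 {r k : ℕ} {U V W : ℕ → ℕ} {g : ℕ → ℕ → ℕ → ℤ} (h : Hive r k U V W g) (b x p : ℕ)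
    (hp : x + b + p + 2 ≤ r) : Qd r g b (x + 1) p ≤ Qd r g b x p := by
  obtain ⟨z, rfl⟩ : ∃ z, r = x + (b + p) + z + 2 := ⟨r - (x + (b+p) + 2), by omega⟩
  have := h.R3 x (b + p) z rfl
  unfold Qd
  rw [show x + (b + p) + z + 2 - x - b - p - 1 = z + 1 by omega,
    show x + (b + p) + z + 2 - x - b - p = z + 2 by omega,
    show x + (b + p) + z + 2 - (x + 1) - b - p - 1 = z by omega,
    show x + (b + p) + z + 2 - (x + 1) - b - p = z + 1 by omega]
  linarith

lemma Qd_zero {r k : ℕ} {U V W : ℕ → ℕ} {g : ℕ → ℕ → ℕ → ℤ} (h : Hive r k U V W g) (b p : ℕ)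
    (hp : b + p + 1 ≤ r) : Qd r g b 0 p = U (p + b) := by
  obtain ⟨z, rfl⟩ : ∃ z, r = (b + p) + 1 + z := ⟨r - ((b+p) + 1), by omega⟩
  have := h.eU (b + p) z rfl
  unfold Qd
  rw [show (b + p) + 1 + z - 0 - b - p - 1 = z by omega,
    show (b + p) + 1 + z - 0 - b - p = z + 1 by omega, this, add_comm b p]

lemma Qd_nonneg {r k : ℕ} {U V W : ℕ → ℕ} {g : ℕ → ℕ → ℕ → ℤ} (h : Hive r k U V W g) (b : ℕ) :
    ∀ x p, x + b + p + 1 ≤ r → 0 ≤ Qd r g b x p := by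
  intro x
  induction x with
  | zero => intro p hp; rw [Qd_zero h b p (by omega)]; positivity
  | succ x ih =>
    intro p hp
    exact (ih (p+1) (by omega)).trans (Qd_R2 h b x p (by omega))

lemma Qf_zero {r k : ℕ} {U V W : ℕ → ℕ} {g : ℕ → ℕ → ℕ → ℤ} (h : Hive r k U V W g) (b : ℕ)
    (hU : ∀ i, r ≤ i → U i = 0) : Qf r g b 0 = dropP b U := by
  funext p
  unfold Qf dropP
  split_ifs with hp
  · rw [Qd_zero h b p (by omega)]; simp
  · rw [hU _ (by omega)]

lemma Qf_strip {r k : ℕ} {U V W : ℕ → ℕ} {g : ℕ → ℕ → ℕ → ℤ} (h : Hive r k U V W g) (b x : ℕ) :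
    Strip (Qf r g b (x + 1)) (Qf r g b x) := by
  constructor
  · intro p
    unfold Qf
    by_cases hp : x + 1 + b + p < r
    · rw [if_pos hp, if_pos (by omega)]
      have := Qd_R3 h b x p (by omega)
      omega
    · rw [if_neg hp]; omega
  · intro p
    unfold Qf
    by_cases hp : x + 1 + b + p < r
    · rw [if_pos hp, if_pos (by omega)]
      have := Qd_R2 h b x p (by omega)
      omega
    · rw [if_neg hp, if_neg (by omega)]

lemma Qf_ps {r k : ℕ} {U V W : ℕ → ℕ} {g : ℕ → ℕ → ℕ → ℤ} (h : Hive r k U V W g) (b x p : ℕ)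
    (hp : x + b + p ≤ r) :
    (ps (Qf r g b x) p : ℤ) = g x (b + p) (r - x - b - p) - g x b (r - x - b) := by
  induction p with
  | zero => simp [ps_zero]
  | succ p ih =>
    rw [ps_succ]
    push_cast
    rw [ih (by omega), Qf, if_pos (by omega), Int.toNat_of_nonneg (Qd_nonneg h b x p (by omega)), Qd]
    rw [show r - x - b - (p + 1) = r - x - b - p - 1 by omega, show b + (p + 1) = b + p + 1 by omega]
    ring

lemma Qf_ps' {r k : ℕ} {U V W : ℕ → ℕ} {g : ℕ → ℕ → ℕ → ℤ} (h : Hive r k U V W g) (b x p : ℕ)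
    (hx : x + b ≤ r) (hp : r ≤ x + b + p) :
    (ps (Qf r g b x) p : ℤ) = g x (r - x) 0 - g x b (r - x - b) := by
  rw [ps_stab (N := r - x - b) (fun q hq => by rw [Qf, if_neg (by omega)]) p (by omega),
    Qf_ps h b x _ (by omega), show b + (r - x - b) = r - x by omega, Nat.sub_self]

lemma trap {r k : ℕ} {U V W : ℕ → ℕ} {g : ℕ → ℕ → ℕ → ℤ} (h : Hive r k U V W g) {a b c : ℕ}
    (habc : a + b + c = r) (hU : ∀ i, r ≤ i → U i = 0) (hUd : ∀ i j, i ≤ j → U j ≤ U i)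
    (hVd : ∀ i j, i ≤ j → V j ≤ V i) (hV : ∀ i, V i ≤ k)
    (hk : ∀ x, x < a → 0 ≤ g x b (r - x - b) - g (x + 1) b (r - (x + 1) - b) + k) :
    ∃ β, LRChain β (Qf r g b a) (dropP b U) ∧
      LRChain (kap r k g a b) β (compP k a (takeP a V)) := by
  have hs0 : Strip (Qf r g b 0) (Qf r g b 0) := by
    rw [Qf_zero h b hU]
    exact ⟨fun _ => le_rfl, fun p => hUd _ _ (by omega)⟩
  have hkap : ∀ x j, x + j + 1 = a →
      (kap r k g a b j : ℤ) = g x b (r - x - b) - g (x + 1) b (r - (x + 1) - b) + k := by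
    intro x j e
    rw [kap, if_pos (by omega), show a - j - 1 = x by omega, show a - j = x + 1 by omega,
      Int.toNat_of_nonneg (hk x (by omega))]
  have hV' : ∀ x, x + 1 ≤ r → g (x + 1) (r - (x + 1)) 0 - g x (r - x) 0 = V x := by
    intro x hx
    have := h.eV x (r - (x + 1)) (by omega)
    rw [show r - (x + 1) + 1 = r - x by omega] at this
    exact this
  have := switch (S := fun j => Qf r g b (a - j)) (κ := kap r k g a b)
    (lam := compP k a (takeP a V)) (N := r) ?_ ?_ ?_ ?_ ?_ ?_
  · simp only [Nat.sub_zero, show a - r = 0 by omega, Qf_zero h b hU] at this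
    exact this
  · intro j
    beta_reduce
    by_cases hj : j < a
    · have := Qf_strip h b (a - (j + 1))
      rwa [show a - (j + 1) + 1 = a - j by omega] at this
    · rw [show a - j = 0 by omega, show a - (j + 1) = 0 by omega]; exact hs0
  · intro j p hp
    simp only [Qf]; rw [if_neg (by omega)]
  · intro j hj
    beta_reduce
    rw [show a - j = 0 by omega, show a - r = 0 by omega]
  · intro j hj
    rw [kap, if_neg (by omega)]
  · intro j p
    beta_reduce
    by_cases hj : j + 2 ≤ a
    · obtain ⟨x, rfl⟩ : ∃ x, a = x + j + 2 := ⟨a - j - 2, by omega⟩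
      rw [show x + j + 2 - (j + 2) = x by omega, show x + j + 2 - (j + 1) = x + 1 by omega,
        show x + j + 2 - j = x + 2 by omega]
      have k1 := hkap x (j + 1) (by omega)
      have k2 := hkap (x + 1) j (by omega)
      by_cases hp : x + b + p + 2 ≤ r
      · have := h.R1 x (b + p) (r - (x + b + p + 2)) (by omega)
        have q1 := Qf_ps h b x (p + 1) (by omega)
        have q2 := Qf_ps h b (x + 2) p (by omega)
        have q3 := Qf_ps h b (x + 1) (p + 1) (by omega)
        have q4 := Qf_ps h b (x + 1) p (by omega)
        rw [show r - x - b - (p + 1) = r - (x + b + p + 2) + 1 by omega] at q1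
        rw [show r - (x + 2) - b - p = r - (x + b + p + 2) by omega] at q2
        rw [show r - (x + 1) - b - (p + 1) = r - (x + b + p + 2) by omega] at q3
        rw [show r - (x + 1) - b - p = r - (x + b + p + 2) + 1 by omega] at q4
        have e1 : x + 1 + 1 = x + 2 := rfl
        have e2 : b + (p + 1) = b + p + 1 := rfl
        simp only [e1, e2] at *
        zify
        linarith
      · have q1 := Qf_ps' h b x (p + 1) (by omega) (by omega)
        have q2 := Qf_ps' h b (x + 2) p (by omega) (by omega)
        have q3 := Qf_ps' h b (x + 1) (p + 1) (by omega) (by omega)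
        have q4 := Qf_ps' h b (x + 1) p (by omega) (by omega)
        have v1 := hV' x (by omega)
        have v2 := hV' (x + 1) (by omega)
        have v3 := hVd x (x + 1) (by omega)
        have e1 : x + 1 + 1 = x + 2 := rfl
        simp only [e1] at *
        zify at v3 ⊢
        linarith
    · rw [show a - (j + 2) = 0 by omega, show a - (j + 1) = 0 by omega]
      have : kap r k g a b (j + 1) = 0 := by rw [kap, if_neg (by omega)]
      rw [this]
      by_cases hj' : j < a
      · rw [show a - j = 0 + 1 by omega]
        have := ps_mono (Qf_strip h b 0).1 p
        omega
      · rw [show a - j = 0 by omega]; omega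
  · intro j
    beta_reduce
    by_cases hj : j < a
    · obtain ⟨x, rfl⟩ : ∃ x, a = x + j + 1 := ⟨a - j - 1, by omega⟩
      rw [show x + j + 1 - (j + 1) = x by omega, show x + j + 1 - j = x + 1 by omega]
      have k1 := hkap x j (by omega)
      have q1 := Qf_ps' h b x r (by omega) (by omega)
      have q2 := Qf_ps' h b (x + 1) r (by omega) (by omega)
      have v1 := hV' x (by omega)
      have : compP k (x + j + 1) (takeP (x + j + 1) V) j = k - V x := by
        simp only [compP, takeP]
        rw [if_pos (by omega), if_pos (by omega), show x + j + 1 - 1 - j = x by omega]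
      have := hV x
      omega
    · rw [show a - j = 0 by omega, show a - (j + 1) = 0 by omega, kap, if_neg hj, compP, if_neg hj]

lemma kap_rot {r k : ℕ} (g : ℕ → ℕ → ℕ → ℤ) {a b c : ℕ} (habc : a + b + c = r) :
    kap r k (rot k g) c a = Qf r g b a := by
  funext j
  unfold kap Qf
  by_cases hj : j < c
  · rw [if_pos hj, if_pos (by omega)]
    congr 1
    unfold rot Qd
    rw [show r - (c - j - 1) - a = b + j + 1 by omega, show r - (c - j) - a = b + j by omega,
      show r - a - b - j - 1 = c - j - 1 by omega, show r - a - b - j = c - j by omega]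
    have : ((c - j : ℕ) : ℤ) = ((c - j - 1 : ℕ) : ℤ) + 1 := by omega
    rw [this]; ring
  · rw [if_neg hj, if_neg (by omega)]

lemma kap_nonneg {r k : ℕ} {U V W : ℕ → ℕ} {g : ℕ → ℕ → ℕ → ℤ} (h : Hive r k U V W g) {a b c : ℕ}
    (habc : a + b + c = r) (x : ℕ) (hx : x < c) :
    0 ≤ rot k g x a (r - x - a) - rot k g (x + 1) a (r - (x + 1) - a) + k := by
  have := Qd_nonneg h b a (c - x - 1) (by omega)
  unfold rot
  unfold Qd at this
  rw [show r - a - b - (c - x - 1) - 1 = x by omega, show r - a - b - (c - x - 1) = x + 1 by omega,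
    show b + (c - x - 1) + 1 = r - x - a by omega,
    show b + (c - x - 1) = r - (x + 1) - a by omega] at this
  push_cast
  linarith

lemma Qf_rot3 (r k : ℕ) (g : ℕ → ℕ → ℕ → ℤ) (b a : ℕ) :
    Qf r (rot k (rot k (rot k g))) b a = Qf r g b a := by
  funext p
  unfold Qf
  by_cases hp : a + b + p < r
  · rw [if_pos hp, if_pos hp]
    congr 1
    unfold Qd rot
    have : ((r - a - b - p : ℕ) : ℤ) = ((r - a - b - p - 1 : ℕ) : ℤ) + 1 := by omega
    rw [this]; push_cast; ring
  · rw [if_neg hp, if_neg hp]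

/-- **Theorem (nonvanishing of a multiple Newell–Littlewood number).**
Let `1 ≤ r < n` and `λ,μ,ν ⊆ ((n−r)^r)` with `c^{ν^{∨[(n−r)^r]}}_{λ,μ} > 0`,
and let `a'+b'+c' = r`.  Then
`N_{λ⁻,μ⁺,ν⁻,λ⁺,μ⁻,ν⁺} > 0`, where `λ⁻ = (λ_{≤a'})^{∨[(n−r)^{a'}]}`,
`λ⁺ = λ_{>a'}`, etc. -/
theorem stmt11 (n r : ℕ) (hr1 : 1 ≤ r) (hrn : r < n) (lam mu nu : ℕ → ℕ)
    (hl : MemParN r lam) (hl1 : lam 0 ≤ n - r)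
    (hm : MemParN r mu) (hm1 : mu 0 ≤ n - r)
    (hv : MemParN r nu) (hv1 : nu 0 ≤ n - r)
    (hc : 0 < lrCoeff lam mu (compP (n - r) r nu))
    (a' b' c' : ℕ) (habc : a' + b' + c' = r) :
    0 < NL6 (compP (n - r) a' (takeP a' lam)) (dropP b' mu)
      (compP (n - r) c' (takeP c' nu)) (dropP a' lam)
      (compP (n - r) b' (takeP b' mu)) (dropP c' nu) := by

  have hL : ∀ i, lam i ≤ n - r := fun i => (hl.1.1 0 i (Nat.zero_le _)).trans hl1
  have hM : ∀ i, mu i ≤ n - r := fun i => (hm.1.1 0 i (Nat.zero_le _)).trans hm1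
  have hV : ∀ i, nu i ≤ n - r := fun i => (hv.1.1 0 i (Nat.zero_le _)).trans hv1
  obtain ⟨g, h⟩ := hive_of_chain hV (chain_comm ((lr_pos_iff _ _ _).1 hc))
  have e1 : c' + a' + b' = r := by omega
  have e2 : b' + c' + a' = r := by omega
  obtain ⟨β1, t1, t2⟩ := trap h.rot e1 hl.2 hl.1.1 hv.1.1 hV (kap_nonneg h habc)
  obtain ⟨β2, t3, t4⟩ := trap h.rot.rot e2 hv.2 hv.1.1 hm.1.1 hM (kap_nonneg h.rot e1)
  obtain ⟨β3, t5, t6⟩ := trap h.rot.rot.rot habc hm.2 hm.1.1 hl.1.1 hL (kap_nonneg h.rot.rot e2)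
  rw [kap_rot g habc] at t2
  rw [kap_rot _ e1] at t4
  rw [kap_rot _ e2] at t6
  rw [Qf_rot3] at t5
  exact NL6_pos t6 t5 t2 t1 t4 t3
end

section
/- Let λ, μ, ν be partitions and let a' and ℓ be positive integers. Assume λ has at most ℓ parts and that there exists a ballot semistandard skew tableau T of shape ν/μ and content λ all of whose entries in rows strictly below row ℓ are at most a'. Then there exists a partition ρ such that c^ν_{ρ, λ_{≤a'}} > 0, c^ρ_{μ, λ_{>a'}} > 0, and ρ_i = μ_i for every i > ℓ − a'. -/
namespace LRS

def cum (x : ℕ → ℕ) (r : ℕ) : ℕ := ∑ s ∈ Finset.range r, x s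

def Bal (x y : ℕ → ℕ) : Prop := ∀ r, cum y (r+1) ≤ cum x r

noncomputable def Uf (x y : ℕ → ℕ) (r : ℕ) : ℕ :=
  sInf {v | ∃ s, r ≤ s ∧ v = cum x s - cum y (s+1)}

noncomputable def Mf (x y : ℕ → ℕ) (r : ℕ) : ℕ :=
  (cum x (r+1) - Uf x y (r+1)) - (cum x r - Uf x y r)

noncomputable def Nf (x y : ℕ → ℕ) (r : ℕ) : ℕ := x r + y r - Mf x y r

lemma cum_zero (x : ℕ → ℕ) : cum x 0 = 0 := by simp [cum]

lemma cum_succ (x : ℕ → ℕ) (r : ℕ) : cum x (r+1) = cum x r + x r := by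
  simp [cum, Finset.sum_range_succ]

lemma cum_mono (x : ℕ → ℕ) : Monotone (cum x) :=
  monotone_nat_of_le_succ fun r => by rw [cum_succ]; omega

lemma U_le {x y : ℕ → ℕ} (h : Bal x y) {r s : ℕ} (hs : r ≤ s) :
    Uf x y r + cum y (s+1) ≤ cum x s := by
  have : Uf x y r ≤ cum x s - cum y (s+1) := Nat.sInf_le ⟨s, hs, rfl⟩
  have := h s
  omega

lemma U_ex {x y : ℕ → ℕ} (h : Bal x y) (r : ℕ) :
    ∃ s, r ≤ s ∧ Uf x y r + cum y (s+1) = cum x s := by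
  have : Uf x y r ∈ {v | ∃ s, r ≤ s ∧ v = cum x s - cum y (s+1)} :=
    Nat.sInf_mem ⟨_, r, le_rfl, rfl⟩
  obtain ⟨s, hs, e⟩ := this
  have := h s
  exact ⟨s, hs, by omega⟩

lemma U_mono {x y : ℕ → ℕ} (h : Bal x y) : Monotone (Uf x y) := by
  intro r r' hr
  obtain ⟨s, hs, e⟩ := U_ex h r'
  have := U_le h (hr.trans hs)
  omega

lemma U_step {x y : ℕ → ℕ} (h : Bal x y) (r : ℕ) :
    Uf x y r + cum y (r+1) = cum x r ∨ Uf x y r = Uf x y (r+1) := by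
  obtain ⟨s, hs, e⟩ := U_ex h r
  rcases hs.eq_or_lt with rfl | hs
  · exact Or.inl e
  · right
    have := U_le h (r := r+1) hs
    have := U_mono h (Nat.le_succ r)
    simp only [Nat.succ_eq_add_one] at this
    omega

lemma U_zero {x y : ℕ → ℕ} (h : Bal x y) : Uf x y 0 = 0 := by
  have := U_le h (le_refl 0)
  rw [cum_zero] at this
  omega

lemma M_add {x y : ℕ → ℕ} (h : Bal x y) (r : ℕ) :
    Mf x y r + Uf x y (r+1) = x r + Uf x y r := by
  unfold Mf
  have h1 := U_le h (le_refl r)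
  have h2 := U_le h (le_refl (r+1))
  have h3 := U_mono h (Nat.le_succ r)
  have h4 := cum_succ y (r+1)
  have h5 := cum_succ x r
  simp only [Nat.succ_eq_add_one] at h3
  rcases U_step h r with h6 | h6 <;> omega

lemma N_add {x y : ℕ → ℕ} (h : Bal x y) (r : ℕ) :
    Nf x y r + Uf x y r = y r + Uf x y (r+1) := by
  unfold Nf
  have h1 := M_add h r
  have h3 := U_mono h (Nat.le_succ r)
  simp only [Nat.succ_eq_add_one] at h3
  omega

lemma cum_M {x y : ℕ → ℕ} (h : Bal x y) (r : ℕ) :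
    cum (Mf x y) r + Uf x y r = cum x r := by
  induction r with
  | zero => simp [cum_zero, U_zero h]
  | succ r ih => rw [cum_succ, cum_succ]; have := M_add h r; omega

lemma cum_N {x y : ℕ → ℕ} (h : Bal x y) (r : ℕ) :
    cum (Nf x y) r = cum y r + Uf x y r := by
  induction r with
  | zero => simp [cum_zero, U_zero h]
  | succ r ih => rw [cum_succ, cum_succ]; have := N_add h r; omega

lemma bal_left {x y z : ℕ → ℕ} (h : Bal x y) (h' : Bal y z) : Bal x (Mf y z) := by
  intro r
  have := cum_M h' (r+1)
  have := h r
  omega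

lemma bal_right {x y z : ℕ → ℕ} (h : Bal x y) (h' : Bal y z) : Bal (Nf x y) z := by
  intro r
  have := cum_N h r
  have := h' r
  omega

lemma claimB {x y z : ℕ → ℕ} (h : Bal x y) (h' : Bal y z) :
    Bal (Mf x y) (Mf (Nf x y) z) := by
  intro r
  have h2 := bal_right h h'
  obtain ⟨s, hs, e⟩ := U_ex h2 (r+1)
  have a1 := cum_M h2 (r+1)
  have a2 := cum_N h (r+1)
  have a3 := cum_N h s
  have a4 := U_mono h hs
  have a5 := h' s
  have a6 := cum_M h r
  have a7 := U_le h (le_refl r)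
  omega

lemma claimA {x y z : ℕ → ℕ} (h : Bal x y) (h' : Bal y z) :
    Bal (Nf x (Mf y z)) (Nf y z) := by
  intro r
  have h2 := bal_left h h'
  obtain ⟨s, hs, e⟩ := U_ex h2 r
  have a1 := cum_N h2 r
  have a2 := cum_N h' (r+1)
  have a3 := cum_M h' (s+1)
  have a4 := U_mono h' (Nat.succ_le_succ hs)
  have a5 := h s
  have a6 := cum_M h' r
  have a7 := U_le h' (le_refl r)
  simp only [Nat.succ_eq_add_one] at a4
  omega

def HS (k s : ℕ → ℕ) : Prop := ∀ r, s (r+1) ≤ k r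

def ZB (N : ℕ) (x : ℕ → ℕ) : Prop := ∀ r, N ≤ r → x r = 0

lemma hs_swap {k x y : ℕ → ℕ} (h : Bal x y) (h1 : HS k (k + x)) (h2 : HS (k + x) (k + x + y)) :
    HS k (k + Mf x y) ∧ HS (k + Mf x y) (k + Mf x y + Nf x y) ∧
      k + Mf x y + Nf x y = k + x + y := by
  have e : k + Mf x y + Nf x y = k + x + y := by
    funext r
    have := M_add h r
    have := N_add h r
    simp only [Pi.add_apply]; omega
  refine ⟨?_, ?_, e⟩
  · intro r
    have a1 := h1 r
    have a2 := M_add h (r+1)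
    have a3 := U_mono h (Nat.le_succ (r+1))
    simp only [Nat.succ_eq_add_one] at a3
    simp only [Pi.add_apply] at *; omega
  · rw [e]
    intro r
    have a0 := h1 r
    have a1 := h2 r
    have a2 := M_add h r
    simp only [Pi.add_apply] at *
    rcases U_step h r with h6 | h6
    · have := U_le h (le_refl (r+1))
      have := cum_succ y (r+1)
      have := cum_succ x r
      omega
    · omega

lemma cum_ZB {N : ℕ} {x : ℕ → ℕ} (h : ZB N x) {r : ℕ} (hr : N ≤ r) : cum x r = cum x N := by
  induction r, hr using Nat.le_induction with
  | base => rfl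
  | succ r hr ih => rw [cum_succ, ih, h r hr, add_zero]

lemma ZB_of_cum {N : ℕ} {x : ℕ → ℕ} (h : ∀ r, N ≤ r → cum x r = cum x N) : ZB N x := by
  intro r hr
  have := h r hr
  have := h (r+1) (by omega)
  rw [cum_succ] at this
  omega

lemma ZB_M {N : ℕ} {x y : ℕ → ℕ} (h : Bal x y) (hx : ZB N x) : ZB N (Mf x y) := by
  intro r hr
  have := M_add h r
  have := hx r hr
  have := U_mono h (Nat.le_succ r)
  simp only [Nat.succ_eq_add_one] at this
  omega

lemma ZB_N {N : ℕ} {x y : ℕ → ℕ} (hx : ZB N x) (hy : ZB N y) : ZB N (Nf x y) := by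
  intro r hr
  simp [Nf, hx r hr, hy r hr]

lemma tot {N : ℕ} {x y : ℕ → ℕ} (h : Bal x y) (hx : ZB N x) (hy : ZB N y) :
    cum (Mf x y) N = cum y N ∧ cum (Nf x y) N = cum x N := by
  have a1 := cum_M h N
  have a2 := cum_N h N
  obtain ⟨s, hs, e⟩ := U_ex h N
  rw [cum_ZB hx hs, cum_ZB hy (by omega : N ≤ s+1)] at e
  omega

lemma ZB_M' {L : ℕ} {x y : ℕ → ℕ} (h : Bal x y) (hy : ZB L y) : ZB (L-1) (Mf x y) := by
  have key : ∀ r, L - 1 ≤ r → cum (Mf x y) r = cum y L := by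
    intro r hr
    have a1 := cum_M h r
    obtain ⟨s, hs, e⟩ := U_ex h r
    have a2 := U_le h (le_refl r)
    rw [cum_ZB hy (by omega)] at e a2
    have := cum_mono x hs
    omega
  exact ZB_of_cum fun r hr => (key r hr).trans (key _ le_rfl).symm

noncomputable def passL : (ℕ → ℕ) → List (ℕ → ℕ) → List (ℕ → ℕ)
  | _, [] => []
  | x, y :: ys => Mf x y :: passL (Nf x y) ys

noncomputable def passX : (ℕ → ℕ) → List (ℕ → ℕ) → (ℕ → ℕ)
  | x, [] => x
  | x, y :: ys => passX (Nf x y) ys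

def HSC : (ℕ → ℕ) → List (ℕ → ℕ) → (ℕ → ℕ) → Prop
  | k, [], t => k = t
  | k, x :: L, t => HS k (k + x) ∧ HSC (k + x) L t

lemma HSC_append (k : ℕ → ℕ) (L M : List (ℕ → ℕ)) (t : ℕ → ℕ) :
    HSC k (L ++ M) t ↔ HSC k L (k + L.sum) ∧ HSC (k + L.sum) M t := by
  induction L generalizing k with
  | nil => simp [HSC]
  | cons x L ih => simp only [List.cons_append, HSC, ih, List.sum_cons, ← add_assoc, and_assoc]

abbrev BC (L : List (ℕ → ℕ)) : Prop := List.IsChain Bal L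

lemma BC_step {x y : ℕ → ℕ} {ys} (h : BC (x :: y :: ys)) : Bal x y ∧ BC (Nf x y :: ys) := by
  have h1 : Bal x y := by cases h; assumption
  have h2 : BC (y :: ys) := by cases h; assumption
  refine ⟨h1, ?_⟩
  cases ys with
  | nil => exact List.isChain_singleton _
  | cons z zs =>
    rw [BC, List.isChain_cons_cons] at h2 ⊢
    exact ⟨bal_right h1 h2.1, h2.2⟩

lemma pass_HSC {k x t : ℕ → ℕ} {B} (h : HSC k (x :: B) t) (hb : BC (x :: B)) :
    HSC k (passL x B ++ [passX x B]) t := by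
  induction B generalizing k x with
  | nil => exact h
  | cons y ys ih =>
    obtain ⟨h1, h2⟩ := BC_step hb
    obtain ⟨g1, g2, g3⟩ := h
    obtain ⟨f1, f2, f3⟩ := hs_swap h1 g1 g2
    refine ⟨f1, ih ⟨f2, ?_⟩ h2⟩
    rw [f3]; exact g3

lemma pass_BC {x : ℕ → ℕ} {B} (hb : BC (x :: B)) : BC (passL x B) := by
  induction B generalizing x with
  | nil => exact List.isChain_nil
  | cons y ys ih =>
    obtain ⟨h1, h2⟩ := BC_step hb
    have := ih h2
    cases ys with
    | nil => exact List.isChain_singleton _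
    | cons z zs =>
      simp only [passL] at this ⊢
      rw [BC, List.isChain_cons_cons]
      have hyz : Bal y z := by
        rw [BC, List.isChain_cons_cons, List.isChain_cons_cons] at hb; exact hb.2.1
      exact ⟨claimB h1 hyz, this⟩

lemma pass_BC' {w x : ℕ → ℕ} {B} (hb : BC (w :: x :: B)) : BC (w :: passL x B) := by
  rw [BC, List.isChain_cons_cons] at hb
  have := pass_BC hb.2
  cases B with
  | nil => exact List.isChain_singleton _
  | cons y ys =>
    simp only [passL] at this ⊢
    rw [BC, List.isChain_cons_cons]
    exact ⟨bal_left hb.1 (BC_step hb.2).1, this⟩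

lemma pass_couple {w x : ℕ → ℕ} {B} (hb : BC (w :: x :: B)) :
    Bal (passX w (passL x B)) (passX x B) := by
  induction B generalizing w x with
  | nil => rw [BC, List.isChain_cons_cons] at hb; exact hb.1
  | cons y ys ih =>
    rw [BC, List.isChain_cons_cons] at hb
    obtain ⟨h1, h2⟩ := BC_step hb.2
    refine ih ?_
    rw [BC, List.isChain_cons_cons]
    exact ⟨claimA hb.1 h1, h2⟩

lemma pass_ZB {N : ℕ} {x : ℕ → ℕ} {B} (hb : BC (x :: B)) (hx : ZB N x) (hB : ∀ y ∈ B, ZB N y) :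
    (∀ y ∈ passL x B, ZB N y) ∧ ZB N (passX x B) ∧
    (passL x B).map (cum · N) = B.map (cum · N) ∧ cum (passX x B) N = cum x N := by
  induction B generalizing x with
  | nil => simp [passL, passX, hx]
  | cons y ys ih =>
    obtain ⟨h1, h2⟩ := BC_step hb
    have hy := hB y (by simp)
    obtain ⟨i1, i2, i3, i4⟩ := ih h2 (ZB_N hx hy) (fun z hz => hB z (by simp [hz]))
    obtain ⟨t1, t2⟩ := tot h1 hx hy
    refine ⟨?_, i2, ?_, ?_⟩
    · intro z hz
      simp only [passL, List.mem_cons] at hz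
      rcases hz with rfl | hz
      · exact ZB_M h1 hx
      · exact i1 z hz
    · simp only [passL, List.map_cons, i3, t1]
    · simp only [passX, i4, t2]

lemma pass_len {L : ℕ} {x : ℕ → ℕ} {B} (hb : BC (x :: B)) (hB : ∀ y ∈ B, ZB L y) :
    ∀ y ∈ passL x B, ZB (L-1) y := by
  induction B generalizing x with
  | nil => simp [passL]
  | cons y ys ih =>
    obtain ⟨h1, h2⟩ := BC_step hb
    intro z hz
    simp only [passL, List.mem_cons] at hz
    rcases hz with rfl | hz
    · exact ZB_M' h1 (hB y (by simp))
    · exact ih h2 (fun z hz => hB z (by simp [hz])) z hz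

noncomputable def allL : List (ℕ → ℕ) → List (ℕ → ℕ) → List (ℕ → ℕ)
  | [], B => B
  | x :: A, B => passL x (allL A B)

noncomputable def allX : List (ℕ → ℕ) → List (ℕ → ℕ) → List (ℕ → ℕ)
  | [], _ => []
  | x :: A, B => passX x (allL A B) :: allX A B

lemma all_BC1 {A B} (h : BC (A ++ B)) : BC (allL A B) ∧
    (∀ w, BC (w :: (A ++ B)) → BC (w :: allL A B)) := by
  induction A with
  | nil => exact ⟨h, fun w hw => hw⟩
  | cons x A ih =>
    have hA : BC (A ++ B) := List.IsChain.of_cons h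
    obtain ⟨i1, i2⟩ := ih hA
    have hx := i2 x h
    refine ⟨pass_BC hx, ?_⟩
    intro w hw
    apply pass_BC'
    rw [List.cons_append, BC, List.isChain_cons_cons] at hw
    rw [BC, List.isChain_cons_cons]
    exact ⟨hw.1, hx⟩

lemma all_BC {A B} (h : BC (A ++ B)) : BC (allL A B) ∧
    (∀ w, BC (w :: (A ++ B)) → BC (w :: allL A B)) ∧ BC (allX A B) := by
  refine ⟨(all_BC1 h).1, (all_BC1 h).2, ?_⟩
  induction A with
  | nil => exact List.isChain_nil
  | cons x A ih =>
    have hA : BC (A ++ B) := List.IsChain.of_cons h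
    have i3 := ih hA
    cases A with
    | nil => exact List.isChain_singleton _
    | cons z A =>
      simp only [allX] at i3 ⊢
      rw [BC, List.isChain_cons_cons]
      refine ⟨?_, i3⟩
      refine pass_couple ?_
      rw [List.cons_append, List.cons_append, BC, List.isChain_cons_cons] at h
      rw [BC, List.isChain_cons_cons]
      exact ⟨h.1, (all_BC1 (List.IsChain.of_cons hA)).2 z hA⟩

lemma all_HSC {A B} {k t : ℕ → ℕ} (h : BC (A ++ B)) (hc : HSC k (A ++ B) t) :
    HSC k (allL A B ++ allX A B) t := by
  induction A generalizing k with
  | nil => simpa [allL, allX] using hc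
  | cons x A ih =>
    have hA : BC (A ++ B) := List.IsChain.of_cons h
    obtain ⟨g1, g2⟩ := hc
    have g3 := ih hA g2
    have hx := (all_BC hA).2.1 x h
    rw [HSC_append] at g3
    have := pass_HSC (k := k) (x := x) ⟨g1, g3.1⟩ hx
    have e : allL (x :: A) B ++ allX (x :: A) B
      = (passL x (allL A B) ++ [passX x (allL A B)]) ++ allX A B := by
      simp [allL, allX]
    rw [e, HSC_append]
    have e2 : k + x + (allL A B).sum = k + (passL x (allL A B) ++ [passX x (allL A B)]).sum := by
      have h0 := (HSC_append k (passL x (allL A B) ++ [passX x (allL A B)]) [] _).1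
        (by rw [List.append_nil]; exact this)
      exact h0.2.symm
    rw [e2] at this g3
    exact ⟨this, g3.2⟩

lemma all_ZB {N : ℕ} {A B} (hb : BC (A ++ B)) (hA : ∀ y ∈ A, ZB N y) (hB : ∀ y ∈ B, ZB N y) :
    (∀ y ∈ allL A B, ZB N y) ∧ (∀ y ∈ allX A B, ZB N y) ∧
    (allL A B).map (cum · N) = B.map (cum · N) ∧ (allX A B).map (cum · N) = A.map (cum · N) := by
  induction A with
  | nil => simpa [allL, allX] using hB
  | cons x A ih =>
    have hA' : BC (A ++ B) := List.IsChain.of_cons hb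
    obtain ⟨i1, i2, i3, i4⟩ := ih hA' (fun z hz => hA z (by simp [hz]))
    have hx := (all_BC hA').2.1 x hb
    obtain ⟨j1, j2, j3, j4⟩ := pass_ZB hx (hA x (by simp)) i1
    refine ⟨j1, ?_, j3.trans i3, ?_⟩
    · intro z hz
      simp only [allX, List.mem_cons] at hz
      rcases hz with rfl | hz
      · exact j2
      · exact i2 z hz
    · simp only [allX, List.map_cons, i4, j4]

lemma all_len {L : ℕ} {A B} (hb : BC (A ++ B)) (hB : ∀ y ∈ B, ZB L y) :
    ∀ y ∈ allL A B, ZB (L - A.length) y := by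
  induction A with
  | nil => simpa [allL] using hB
  | cons x A ih =>
    have hA' : BC (A ++ B) := List.IsChain.of_cons hb
    have := pass_len ((all_BC hA').2.1 x hb) (ih hA')
    intro y hy
    have := this y hy
    rw [List.length_cons, ← Nat.sub_sub]
    exact this

lemma lr_pos {a b c : ℕ → ℕ} {T : ℕ → ℕ → ℕ} (h : IsLRTableau a b c T) : 0 < lrCoeff a b c := by
  obtain ⟨N, hN⟩ := h.2.2.1.2
  have hanti := h.2.2.1.1
  obtain ⟨K, hK⟩ := h.2.1.2
  have box : ∀ i j, InSkew a c i j → i < N ∧ j < c 0 := by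
    intro i j hij
    refine ⟨?_, lt_of_lt_of_le hij.2 (hanti 0 i (Nat.zero_le _))⟩
    by_contra hc
    have := hN i (by omega)
    have := hij.2
    omega
  have bound : ∀ S : {T : ℕ → ℕ → ℕ // IsLRTableau a b c T}, ∀ i j, S.1 i j < K + 1 := by
    rintro ⟨S, hS⟩ i j
    by_contra hc
    simp only at hc
    have hin : InSkew a c i j := by
      by_contra h0
      have := hS.2.2.2.2.1 i j h0
      omega
    obtain ⟨v, hv⟩ : ∃ v, S i j = v + 1 := ⟨S i j - 1, by omega⟩
    have hcont := hS.2.2.2.2.2.2.2.2.1 v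
    have hfin : {p : ℕ × ℕ | InSkew a c p.1 p.2 ∧ S p.1 p.2 = v + 1}.Finite := by
      refine ((Set.finite_Iio N).prod (Set.finite_Iio (c 0))).subset ?_
      rintro ⟨p, q⟩ ⟨hp, -⟩
      exact box p q hp
    rw [hK v (by omega), Set.ncard_eq_zero hfin] at hcont
    have : ((i, j) : ℕ × ℕ) ∈ (∅ : Set (ℕ × ℕ)) := by
      rw [← hcont]; exact ⟨hin, hv⟩
    exact this
  have : Finite {T : ℕ → ℕ → ℕ // IsLRTableau a b c T} := by
    refine Finite.of_injective
      (fun S => fun (i : Fin N) (j : Fin (c 0)) => (⟨S.1 i j, bound S i j⟩ : Fin (K+1))) ?_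
    intro S S' e
    apply Subtype.ext
    funext i j
    by_cases hin : InSkew a c i j
    · obtain ⟨h1, h2⟩ := box i j hin
      have := congrFun (congrFun e ⟨i, h1⟩) ⟨j, h2⟩
      simpa using this
    · rw [S.2.2.2.2.2.1 i j hin, S'.2.2.2.2.2.1 i j hin]
  have : Nonempty {T : ℕ → ℕ → ℕ // IsLRTableau a b c T} := ⟨⟨T, h⟩⟩
  exact Nat.card_pos

def dd (P : ℕ → ℕ → ℕ) (i : ℕ) : ℕ → ℕ := fun r => P (i+1) r - P i r

lemma count {P T : ℕ → ℕ → ℕ} {i : ℕ}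
    (hT : ∀ r j, T r j = i + 1 ↔ P i r ≤ j ∧ j < P (i+1) r) (R : ℕ) :
    {p : ℕ × ℕ | p.1 < R ∧ T p.1 p.2 = i + 1}.Finite ∧
    {p : ℕ × ℕ | p.1 < R ∧ T p.1 p.2 = i + 1}.ncard = cum (dd P i) R := by
  let s : Finset (Σ _ : ℕ, ℕ) := (Finset.range R).sigma (fun r => Finset.Ico (P i r) (P (i+1) r))
  have e : {p : ℕ × ℕ | p.1 < R ∧ T p.1 p.2 = i + 1}
      = (Equiv.sigmaEquivProd ℕ ℕ) '' (s : Set (Σ _ : ℕ, ℕ)) := by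
    ext ⟨p, q⟩
    constructor
    · rintro ⟨h1, h2⟩
      refine ⟨⟨p, q⟩, ?_, rfl⟩
      simp only [s, Finset.coe_sigma, Set.mem_sigma_iff, Finset.mem_coe, Finset.mem_range, Finset.mem_Ico]
      exact ⟨h1, (hT p q).1 h2⟩
    · rintro ⟨⟨p', q'⟩, h1, h2⟩
      simp only [Equiv.sigmaEquivProd_apply, Prod.mk.injEq] at h2
      obtain ⟨rfl, rfl⟩ := h2
      simp only [s, Finset.coe_sigma, Set.mem_sigma_iff, Finset.mem_coe, Finset.mem_range, Finset.mem_Ico] at h1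
      exact ⟨h1.1, (hT _ _).2 h1.2⟩
  constructor
  · rw [e]; exact s.finite_toSet.image _
  · rw [e, Set.ncard_image_of_injective _ (Equiv.injective _), Set.ncard_coe_finset]
    simp [s, cum, dd]

/-- chain of partitions to tableau -/
lemma build {ka mu' ta : ℕ → ℕ} {P : ℕ → ℕ → ℕ} {N n : ℕ} (hka : IsPartition ka)
    (hmu : IsPartition mu') (hta : IsPartition ta) (hN : ∀ r, N ≤ r → ta r = 0)
    (P0 : P 0 = ka) (Pn : P n = ta) (Pm : ∀ r, Monotone (fun i => P i r))
    (Ple : ∀ i r, P i r ≤ ta r)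
    (hHS : ∀ i, HS (P i) (P (i+1))) (hbal : ∀ i, Bal (dd P i) (dd P (i+1)))
    (hc : ∀ i, mu' i = cum (dd P i) N) : ∃ T, IsLRTableau ka mu' ta T := by
  classical
  let T : ℕ → ℕ → ℕ := fun r j => if InSkew ka ta r j then sInf {i | j < P i r} else 0
  have Tin : ∀ r j, InSkew ka ta r j → ∀ i, (T r j ≤ i ↔ j < P i r) := by
    intro r j h i
    simp only [T, if_pos h]
    constructor
    · intro hi
      have : sInf {i | j < P i r} ∈ {i | j < P i r} := Nat.sInf_mem ⟨n, by
        show j < P n r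
        rw [Pn]; exact h.2⟩
      exact lt_of_lt_of_le this (Pm r hi)
    · intro hi; exact Nat.sInf_le hi
  have Tout : ∀ r j, ¬ InSkew ka ta r j → T r j = 0 := fun r j h => if_neg h
  have Pge : ∀ i r, ka r ≤ P i r := by
    intro i r
    rw [← P0]; exact Pm r (Nat.zero_le i)
  have Teq : ∀ i r j, T r j = i + 1 ↔ P i r ≤ j ∧ j < P (i+1) r := by
    intro i r j
    by_cases h : InSkew ka ta r j
    · have h1 := Tin r j h i
      have h2 := Tin r j h (i+1)
      omega
    · rw [Tout r j h]
      constructor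
      · omega
      · rintro ⟨h1, h2⟩
        exact absurd ⟨(Pge i r).trans h1, lt_of_lt_of_le h2 (Ple _ r)⟩ h
  have Tpos : ∀ i j, InSkew ka ta i j → 1 ≤ T i j := by
    intro r j h
    by_contra hc
    have := (Tin r j h 0).1 (by omega)
    rw [P0] at this
    have := h.1
    omega
  have Tsk : ∀ i j, 1 ≤ T i j → InSkew ka ta i j := by
    intro r j h
    by_contra hc
    rw [Tout r j hc] at h; omega
  have Panti : ∀ i, Antitone (P (i+1)) := fun i => antitone_nat_of_succ_le fun r =>
    (hHS i r).trans (Pm r (Nat.le_succ i))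
  refine ⟨T, hka, hmu, hta, ?_, Tout, Tpos, ?_, ?_, ?_, ?_⟩
  · intro r; exact (Pge 0 r).trans (Ple 0 r)
  · intro r j j' h h' hj
    rw [Tin r j h]
    exact lt_of_le_of_lt hj ((Tin r j' h' _).1 le_rfl)
  · intro r r' j h h' hr
    obtain ⟨v, hv⟩ : ∃ v, T r' j = v + 1 := ⟨T r' j - 1, by have := Tpos r' j h'; omega⟩
    have h1 := (Tin r' j h' (v+1)).1 hv.le
    have h2 := Panti v (show r + 1 ≤ r' from hr)
    have h3 := hHS v r
    have := (Tin r j h v).2 (by omega)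
    omega
  · intro i
    rw [hc, ← (count (Teq i) N).2]
    congr 1
    ext ⟨p, q⟩
    simp only [Set.mem_ofPred_eq]
    constructor
    · rintro ⟨h1, h2⟩
      refine ⟨?_, h2⟩
      by_contra hh
      have := hN p (by omega)
      have := h1.2
      omega
    · rintro ⟨h1, h2⟩
      exact ⟨Tsk p q (by omega), h2⟩
  · rintro i ⟨r, j⟩ h hq
    calc _ ≤ {p : ℕ × ℕ | p.1 < r+1 ∧ T p.1 p.2 = (i+1) + 1}.ncard := by
          apply Set.ncard_le_ncard _ (count (Teq (i+1)) (r+1)).1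
          rintro ⟨p, q⟩ ⟨h1, h2, h3⟩
          refine ⟨?_, h2⟩
          simp only [ReadBefore] at h3 ⊢
          omega
      _ = cum (dd P (i+1)) (r+1) := (count (Teq (i+1)) (r+1)).2
      _ ≤ cum (dd P i) r := hbal i r
      _ = {p : ℕ × ℕ | p.1 < r ∧ T p.1 p.2 = i + 1}.ncard := (count (Teq i) r).2.symm
      _ ≤ _ := by
          apply Set.ncard_le_ncard
          · rintro ⟨p, q⟩ ⟨h1, h2⟩
            exact ⟨Tsk p q (by simp only at h2; omega), h2, Or.inl h1⟩
          · refine (count (Teq i) (r+1)).1.subset ?_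
            rintro ⟨p, q⟩ ⟨h1, h2, h3⟩
            refine ⟨?_, h2⟩
            simp only [ReadBefore] at h3 ⊢
            omega

/-- tableau to chain of partitions -/
lemma extract {mu lam nu : ℕ → ℕ} {T : ℕ → ℕ → ℕ} (h : IsLRTableau mu lam nu T) {N n : ℕ}
    (hN : ∀ r, N ≤ r → nu r = 0) (hn : ∀ i, n ≤ i → lam i = 0) :
    ∃ P : ℕ → ℕ → ℕ, P 0 = mu ∧ P n = nu ∧ (∀ r, Monotone (fun i => P i r)) ∧
      (∀ i r, P i r ≤ nu r) ∧ (∀ i, HS (P i) (P (i+1))) ∧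
      (∀ i, Bal (dd P i) (dd P (i+1))) ∧ (∀ i, cum (dd P i) N = lam i) ∧
      (∀ i r j, T r j = i + 1 ↔ P i r ≤ j ∧ j < P (i+1) r) := by
  obtain ⟨hmu, hlam, hnu, hle, Tout, Tpos, Trow, Tcol, Tcont, Tbal⟩ := h
  let P : ℕ → ℕ → ℕ := fun i r => sInf {j | mu r ≤ j ∧ (j < nu r → i < T r j)}
  have Pmem : ∀ i r, mu r ≤ P i r ∧ (P i r < nu r → i < T r (P i r)) := by
    intro i r
    exact Nat.sInf_mem (s := {j | mu r ≤ j ∧ (j < nu r → i < T r j)})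
      ⟨nu r, hle r, fun h => absurd h (lt_irrefl _)⟩
  have Ple : ∀ i r, P i r ≤ nu r := fun i r =>
    Nat.sInf_le ⟨hle r, fun h => absurd h (lt_irrefl _)⟩
  have Tin : ∀ r j, InSkew mu nu r j → ∀ i, (T r j ≤ i ↔ j < P i r) := by
    intro r j hj i
    constructor
    · intro hi
      by_contra hc
      have h1 : P i r < nu r := lt_of_le_of_lt (not_lt.1 hc) hj.2
      have h2 := (Pmem i r).2 h1
      have h3 := Trow r (P i r) j ⟨(Pmem i r).1, h1⟩ hj (not_lt.1 hc)
      omega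
    · intro hi
      have := Nat.notMem_of_lt_sInf hi
      simp only [Set.mem_ofPred_eq, not_and, Classical.not_imp] at this
      have := (this hj.1).2
      omega
  have Tsk : ∀ i j, 1 ≤ T i j → InSkew mu nu i j := by
    intro r j h
    by_contra hc
    rw [Tout r j hc] at h; omega
  have Teq : ∀ i r j, T r j = i + 1 ↔ P i r ≤ j ∧ j < P (i+1) r := by
    intro i r j
    by_cases h : InSkew mu nu r j
    · have h1 := Tin r j h i
      have h2 := Tin r j h (i+1)
      omega
    · rw [Tout r j h]
      constructor
      · omega
      · rintro ⟨h1, h2⟩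
        exact absurd ⟨(Pmem i r).1.trans h1, lt_of_lt_of_le h2 (Ple _ r)⟩ h
  have Pm : ∀ r, Monotone (fun i => P i r) := by
    intro r i i' hi
    refine Nat.sInf_le ⟨(Pmem i' r).1, fun h => lt_of_le_of_lt hi ((Pmem i' r).2 h)⟩
  have cont : ∀ i, cum (dd P i) N = lam i := by
    intro i
    rw [← Tcont, ← (count (Teq i) N).2]
    congr 1
    ext ⟨p, q⟩
    simp only [Set.mem_ofPred_eq]
    constructor
    · rintro ⟨h1, h2⟩
      exact ⟨Tsk p q (by omega), h2⟩
    · rintro ⟨h1, h2⟩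
      refine ⟨?_, h2⟩
      by_contra hh
      have := hN p (by omega)
      have := h1.2
      omega
  have Pconst : ∀ i r, n ≤ i → P (i+1) r = P i r := by
    intro i r hi
    have h1 := cont i
    rw [hn i hi] at h1
    have h3 := Pm r (Nat.le_succ i)
    simp only [Nat.succ_eq_add_one] at h3
    by_cases hr : N ≤ r
    · have := hN r hr
      have := Ple (i+1) r
      have := Ple i r
      omega
    · have h2 : dd P i r ≤ cum (dd P i) N :=
        Finset.single_le_sum (f := dd P i) (fun _ _ => Nat.zero_le _) (Finset.mem_range.2 (not_le.1 hr))
      rw [h1] at h2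
      simp only [dd] at h2
      omega
  refine ⟨P, ?_, ?_, Pm, Ple, ?_, ?_, cont, Teq⟩
  · funext r
    refine le_antisymm ?_ (Pmem 0 r).1
    exact Nat.sInf_le ⟨le_rfl, fun h => Tpos r _ ⟨le_rfl, h⟩⟩
  · funext r
    refine le_antisymm (Ple n r) ?_
    by_contra hc
    have hc := not_le.1 hc
    have hin : InSkew mu nu r (P n r) := ⟨(Pmem n r).1, hc⟩
    have h1 := (Tin r _ hin (T r (P n r))).1 le_rfl
    have h2 : ∀ i, n ≤ i → P i r = P n r := by
      intro i hi
      induction i, hi using Nat.le_induction with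
      | base => rfl
      | succ i hi ih => rw [Pconst i r hi, ih]
    rw [h2 _ ((Pmem n r).2 hc).le] at h1
    omega
  · intro i r
    by_contra hc
    have hc := not_le.1 hc
    have a1 := hmu.1 r (r+1) (by omega)
    have a2 := hnu.1 r (r+1) (by omega)
    have a3 := (Pmem i r).1
    have a4 := Ple (i+1) (r+1)
    have i1 : InSkew mu nu (r+1) (P i r) := ⟨by omega, by omega⟩
    have i2 : InSkew mu nu r (P i r) := ⟨by omega, by omega⟩
    have b1 := (Tin _ _ i1 (i+1)).2 hc
    have b2 := Tcol r (r+1) _ i2 i1 (by omega)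
    have b3 := (Tin _ _ i2 i).1 (by omega)
    omega
  · intro i r
    induction r using Nat.strong_induction_on with
    | _ r ih => ?_
    have step : 0 < dd P (i+1) r → cum (dd P (i+1)) (r+1) ≤ cum (dd P i) r := by
      intro hpos
      simp only [dd] at hpos
      have hq : T r (P (i+1) r) = i + 2 := (Teq (i+1) r _).2 ⟨le_rfl, by omega⟩
      have hqs : InSkew mu nu r (P (i+1) r) := Tsk _ _ (by omega)
      have hb := Tbal i (r, P (i+1) r) hqs hq
      calc cum (dd P (i+1)) (r+1)
          = {p : ℕ × ℕ | p.1 < r+1 ∧ T p.1 p.2 = (i+1) + 1}.ncard :=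
            (count (Teq (i+1)) (r+1)).2.symm
        _ ≤ _ := by
            apply Set.ncard_le_ncard
            · rintro ⟨p, q⟩ ⟨h1, h2⟩
              simp only at h1 h2
              refine ⟨Tsk p q (by omega), h2, ?_⟩
              rcases Nat.lt_succ_iff_lt_or_eq.1 h1 with h3 | rfl
              · exact Or.inl h3
              · exact Or.inr ⟨rfl, ((Teq (i+1) p q).1 h2).1⟩
            · refine (count (Teq (i+1)) (r+1)).1.subset ?_
              rintro ⟨p, q⟩ ⟨h1, h2, h3⟩
              refine ⟨?_, h2⟩
              simp only [ReadBefore] at h3 ⊢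
              omega
        _ ≤ _ := hb
        _ ≤ {p : ℕ × ℕ | p.1 < r ∧ T p.1 p.2 = i + 1}.ncard := by
            apply Set.ncard_le_ncard _ (count (Teq i) r).1
            rintro ⟨p, q⟩ ⟨h1, h2, h3⟩
            refine ⟨?_, h2⟩
            rcases h3 with h3 | ⟨h3, h4⟩
            · exact h3
            · simp only at h2 h3 h4
              subst h3
              have := ((Teq i p q).1 h2).2
              omega
        _ = _ := (count (Teq i) r).2
    rcases Nat.eq_zero_or_pos (dd P (i+1) r) with h0 | h0
    · rw [cum_succ, h0, add_zero]
      cases r with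
      | zero => simp [cum_zero]
      | succ r => exact (ih r (Nat.lt_succ_self r)).trans (cum_mono _ (Nat.le_succ r))
    · exact step h0

lemma HSC_list {P : ℕ → ℕ → ℕ} (Pm : ∀ r, Monotone (fun i => P i r))
    (hHS : ∀ i, HS (P i) (P (i+1))) (n : ℕ) : ∀ i,
    HSC (P i) ((List.range' i n).map (dd P)) (P (i+n)) := by
  induction n with
  | zero => intro i; simp [HSC]
  | succ n ih =>
    intro i
    have e : P i + dd P i = P (i+1) := by
      funext r
      have := Pm r (Nat.le_succ i)
      simp only [Nat.succ_eq_add_one] at this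
      simp only [Pi.add_apply, dd]; omega
    rw [List.range'_succ, List.map_cons]
    refine ⟨by rw [e]; exact hHS i, ?_⟩
    rw [e, show i + (n+1) = i + 1 + n by omega]
    exact ih (i+1)

lemma BC_list {d : ℕ → ℕ → ℕ} (h : ∀ i, Bal (d i) (d (i+1))) (n : ℕ) : ∀ i,
    BC ((List.range' i n).map d) := by
  induction n with
  | zero => intro i; exact List.isChain_nil
  | succ n ih =>
    intro i
    have := ih (i+1)
    cases n with
    | zero => exact List.isChain_singleton _
    | succ n =>
      rw [List.range'_succ, List.map_cons] at this
      rw [List.range'_succ, List.range'_succ, List.map_cons, List.map_cons, BC,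
        List.isChain_cons_cons]
      exact ⟨h i, this⟩

lemma HSC_sum {k t : ℕ → ℕ} {L} (h : HSC k L t) : k + L.sum = t := by
  have := (HSC_append k L [] t).1 (by rwa [List.append_nil])
  exact this.2

lemma HSC_anti {k t : ℕ → ℕ} {L} (h : HSC k L t) (hk : ∀ r, k (r+1) ≤ k r) :
    ∀ r, t (r+1) ≤ t r := by
  induction L generalizing k with
  | nil => cases h; exact hk
  | cons x L ih =>
    refine ih h.2 fun r => (h.1 r).trans ?_
    simp

lemma HSC_take {k t : ℕ → ℕ} {L} (h : HSC k L t) (ht : ∀ r, t (r+1) ≤ t r) (i : ℕ) :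
    HS (k + (L.take i).sum) (k + (L.take (i+1)).sum) := by
  induction L generalizing k i with
  | nil => cases h; simpa [HS] using ht
  | cons x L ih =>
    cases i with
    | zero => simpa using h.1
    | succ i =>
      have := ih h.2 i
      simpa [add_assoc] using this

lemma take_succ_sum (L : List (ℕ → ℕ)) (i : ℕ) :
    (L.take (i+1)).sum = (L.take i).sum + L.getD i 0 := by
  induction L generalizing i with
  | nil => simp
  | cons x L ih =>
    cases i with
    | zero => simp
    | succ i => rw [List.take_succ_cons, List.take_succ_cons, List.sum_cons, List.sum_cons, ih,
        List.getD_cons_succ, add_assoc]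

lemma bal_getD {L} (h : BC L) (i : ℕ) : Bal (L.getD i 0) (L.getD (i+1) 0) := by
  induction L generalizing i with
  | nil => intro r; simp [cum]
  | cons x L ih =>
    cases i with
    | succ i =>
      simp only [List.getD_cons_succ]
      exact ih (List.IsChain.of_cons h) i
    | zero =>
      cases L with
      | nil => intro r; simp [cum]
      | cons y L =>
        rw [BC, List.isChain_cons_cons] at h
        simpa using h.1

lemma build_list {ka mu' ta : ℕ → ℕ} {L : List (ℕ → ℕ)} {N : ℕ} (hka : IsPartition ka)
    (hmu : IsPartition mu') (hta : IsPartition ta) (hN : ∀ r, N ≤ r → ta r = 0)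
    (h : HSC ka L ta) (hb : BC L) (hc : ∀ i, mu' i = (L.map (cum · N)).getD i 0) :
    0 < lrCoeff ka mu' ta := by
  have hd : ∀ i, dd (fun i => ka + (L.take i).sum) i = L.getD i 0 := by
    intro i
    funext r
    simp only [dd, take_succ_sum, Pi.add_apply]
    omega
  have Pm : ∀ r, Monotone (fun i => (ka + (L.take i).sum) r) := by
    intro r
    refine monotone_nat_of_le_succ fun i => ?_
    rw [take_succ_sum]
    simp only [Pi.add_apply]
    omega
  have Pn : ∀ i, L.length ≤ i → ka + (L.take i).sum = ta := by
    intro i hi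
    rw [List.take_of_length_le hi, HSC_sum h]
  obtain ⟨T, hT⟩ := build (P := fun i => ka + (L.take i).sum) (N := N) (n := L.length) hka hmu hta hN
    (by simp) (Pn _ le_rfl) Pm
    (by
      intro i r
      rcases le_total L.length i with hi | hi
      · rw [Pn i hi]
      · have := Pm r hi
        simp only at this
        rwa [Pn _ le_rfl] at this)
    (HSC_take h fun r => hta.1 _ _ (Nat.le_succ r))
    (by intro i; rw [hd, hd]; exact bal_getD hb i)
    (by
      intro i
      rw [hd, hc]
      have : (0 : ℕ) = cum (0 : ℕ → ℕ) N := by simp [cum]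
      rw [this, List.getD_map (f := (cum · N))])
  exact lr_pos hT

lemma sum_ZB {L : List (ℕ → ℕ)} {M : ℕ} (h : ∀ y ∈ L, ZB M y) : ZB M L.sum := by
  induction L with
  | nil => intro r _; rfl
  | cons x L ih =>
    intro r hr
    rw [List.sum_cons, Pi.add_apply, h x (by simp) r hr, ih (fun y hy => h y (by simp [hy])) r hr]

end LRS

/-- **Theorem (existence of `ρ` via demotion).**
Let `λ,μ,ν` be partitions, `a', ℓ > 0`, with `ℓ(λ) ≤ ℓ`, and suppose there is
a ballot semistandard skew tableau `T` of shape `ν/μ` and content `λ` whose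
entries in rows strictly below row `ℓ` are at most `a'`.  Then there is a
partition `ρ` with `c^ν_{ρ,λ_{≤a'}} > 0`, `c^ρ_{μ,λ_{>a'}} > 0` and
`ρ_i = μ_i` for all `i > ℓ − a'`. -/
theorem stmt12 (lam mu nu : ℕ → ℕ) (a' l : ℕ) (ha' : 0 < a') (hl0 : 0 < l)
    (hlam : IsPartition lam) (hmu : IsPartition mu) (hnu : IsPartition nu)
    (hlen : ∀ i, l ≤ i → lam i = 0)
    (hT : ∃ T : ℕ → ℕ → ℕ, IsLRTableau mu lam nu T ∧
      ∀ i j, InSkew mu nu i j → l ≤ i → T i j ≤ a') :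
    ∃ rho : ℕ → ℕ, IsPartition rho ∧
      0 < lrCoeff rho (takeP a' lam) nu ∧
      0 < lrCoeff mu (dropP a' lam) rho ∧
      ∀ i, l - a' ≤ i → rho i = mu i := by
  classical
  obtain ⟨T, hLR, hTa⟩ := hT
  obtain ⟨N, hN⟩ := hnu.2
  obtain ⟨n, hn⟩ := hlam.2
  obtain ⟨P, P0, Pn, Pm, Ple, hHS, hbal, hcont, Teq⟩ :=
    LRS.extract hLR (N := N) (n := a' + n) hN (fun i hi => hn i (by omega))
  let A := (List.range' 0 a').map (LRS.dd P)
  let B := (List.range' a' n).map (LRS.dd P)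
  have eAB : A ++ B = (List.range' 0 (a'+n)).map (LRS.dd P) := by
    simp only [A, B, ← List.map_append]
    congr 1
    have := List.range'_append (s := 0) (m := a') (n := n) (step := 1)
    simpa using this
  have hAB : LRS.HSC mu (A ++ B) nu := by
    have := LRS.HSC_list Pm hHS (a'+n) 0
    rw [Nat.zero_add, P0, Pn] at this
    rwa [eAB]
  have bAB : LRS.BC (A ++ B) := by
    rw [eAB]; exact LRS.BC_list hbal _ _
  have zN : ∀ i, LRS.ZB N (LRS.dd P i) := by
    intro i r hr
    have := hN r hr
    have := Ple (i+1) r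
    simp only [LRS.dd]; omega
  have zA : ∀ y ∈ A, LRS.ZB N y := by
    intro y hy
    obtain ⟨i, -, rfl⟩ := List.mem_map.1 hy
    exact zN i
  have zB : ∀ y ∈ B, LRS.ZB N y := by
    intro y hy
    obtain ⟨i, -, rfl⟩ := List.mem_map.1 hy
    exact zN i
  have lB : ∀ y ∈ B, LRS.ZB l y := by
    intro y hy
    obtain ⟨i, hi, rfl⟩ := List.mem_map.1 hy
    have hi := (List.mem_range'_1.1 hi).1
    intro r hr
    by_contra hc
    simp only [LRS.dd] at hc
    have h1 := (Teq i r (P i r)).2 ⟨le_rfl, by omega⟩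
    have h2 : InSkew mu nu r (P i r) := by
      by_contra h0
      have := hLR.2.2.2.2.1 r _ h0
      omega
    have := hTa r _ h2 hr
    omega
  have c1 := LRS.all_HSC bAB hAB
  obtain ⟨b1, -, b2⟩ := LRS.all_BC bAB
  obtain ⟨-, -, t1, t2⟩ := LRS.all_ZB bAB zA zB
  have len := LRS.all_len bAB lB
  have lenA : A.length = a' := by simp [A]
  rw [lenA] at len
  rw [LRS.HSC_append] at c1
  set rho := mu + (LRS.allL A B).sum with hrho
  have rle : ∀ r, rho r ≤ nu r := by
    intro r
    have := LRS.HSC_sum c1.2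
    rw [← this]; simp
  have hrp : IsPartition rho := by
    refine ⟨fun i j hij => ?_, N, fun i hi => ?_⟩
    · exact antitone_nat_of_succ_le
        (LRS.HSC_anti c1.1 fun r => hmu.1 _ _ (Nat.le_succ r)) hij
    · have := rle i
      have := hN i hi
      omega
  refine ⟨rho, hrp, ?_, ?_, ?_⟩
  · refine LRS.build_list hrp ?_ hnu hN c1.2 b2 ?_
    · refine ⟨fun i j hij => ?_, n, fun i hi => ?_⟩
      · have := hlam.1 i j hij
        simp only [takeP]
        split_ifs <;> omega
      · simp [takeP, hn i hi]
    · intro i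
      rw [t2]
      simp only [A, List.map_map, takeP]
      by_cases hi : i < a'
      · rw [if_pos hi, List.getD_eq_getElem _ _ (by simpa using hi)]
        simp [hcont]
      · rw [if_neg hi, List.getD_eq_default _ _ (by simpa using hi)]
  · refine LRS.build_list (N := N) hmu ?_ hrp (fun r hr => ?_) c1.1 b1 ?_
    · exact ⟨fun i j hij => hlam.1 _ _ (by omega), n, fun i hi => hn _ (by omega)⟩
    · have := rle r
      have := hN r hr
      omega
    · intro i
      rw [t1]
      simp only [B, List.map_map, dropP]
      by_cases hi : i < n
      · rw [List.getD_eq_getElem _ _ (by simpa using hi)]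
        simp [hcont, add_comm]
      · rw [List.getD_eq_default _ _ (by simpa using hi), hn _ (by omega)]
  · intro i hi
    rw [hrho, Pi.add_apply, LRS.sum_ZB len i hi, add_zero]
end
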